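/- Let f ∈ Lip(α,p) with p > 1 and 0 < α < 1, and let (a_{n,k}) be a lower triangular matrix with a_{n,k} ≥ 0 for k ≤ n and a_{n,k} = 0 for k > n, satisfying |∑_{k=0}^n a_{n,k} − 1| = O(n^{−α}) (in place of row sums equal to 1). If the rows (a_{n,k})_{k=0}^n belong to AMIMS with a constant independent of n, then ‖T_n(f) − f‖_{L^p} = O(n^{−α}). -/

import Mathlib

open MeasureTheory Finset Real

/-- The Dirichlet kernel `D_n(u) = 1/2 + ∑_{k=1}^n cos(k u)`. -/
noncomputable def dirichletKernel (n : ℕ) (u : ℝ) : ℝ :=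
  1 / 2 + ∑ k ∈ Finset.Icc 1 n, Real.cos (k * u)

/-- The `n`-th partial sum of the Fourier series of a `2π`-periodic function `f`,
`S_n(f;x) = (1/π) ∫_0^{2π} f(t) D_n(x - t) dt`. -/
noncomputable def partialFourierSum (f : ℝ → ℝ) (n : ℕ) (x : ℝ) : ℝ :=
  (1 / Real.pi) * ∫ t in (0 : ℝ)..(2 * Real.pi), f t * dirichletKernel n (x - t)

/-- The normalized `L^p` norm `‖f‖_{L^p} = ((1/2π) ∫_0^{2π} |f(x)|^p dx)^{1/p}`. -/
noncomputable def lpNorm (p : ℝ) (f : ℝ → ℝ) : ℝ :=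
  ((1 / (2 * Real.pi)) * ∫ x in (0 : ℝ)..(2 * Real.pi), |f x| ^ p) ^ (1 / p)

/-- The integral modulus of continuity
`ω_p(f;δ) = sup_{0<|h|≤δ} ((1/2π) ∫_0^{2π} |f(x+h) - f(x)|^p dx)^{1/p}`. -/
noncomputable def intModulus (p : ℝ) (f : ℝ → ℝ) (δ : ℝ) : ℝ :=
  sSup {y : ℝ | ∃ h : ℝ, 0 < |h| ∧ |h| ≤ δ ∧
    y = ((1 / (2 * Real.pi)) * ∫ x in (0 : ℝ)..(2 * Real.pi), |f (x + h) - f x| ^ p) ^ (1 / p)}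

/-- `f ∈ Lip(α,p)`: `f` is `2π`-periodic, belongs to `L^p[0,2π]`, and
`ω_p(f;δ) = O(δ^α)`. -/
def LipClass (α p : ℝ) (f : ℝ → ℝ) : Prop :=
  Function.Periodic f (2 * Real.pi) ∧
  IntervalIntegrable f MeasureTheory.volume 0 (2 * Real.pi) ∧
  IntervalIntegrable (fun x => |f x| ^ p) MeasureTheory.volume 0 (2 * Real.pi) ∧
  ∃ C : ℝ, 0 < C ∧ ∀ δ : ℝ, 0 < δ → intModulus p f δ ≤ C * δ ^ α

/-- The matrix transform `T_n(f;x) = ∑_{k=0}^n a_{n,k} S_k(f;x)`. -/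
noncomputable def matrixMeans (a : ℕ → ℕ → ℝ) (f : ℝ → ℝ) (n : ℕ) (x : ℝ) : ℝ :=
  ∑ k ∈ Finset.range (n + 1), a n k * partialFourierSum f k x

/-- `A_{n,m} = (1/(m+1)) ∑_{k=0}^m a_{n,k}`, the Cesàro mean of the `n`-th row. -/
noncomputable def rowMean (a : ℕ → ℕ → ℝ) (n m : ℕ) : ℝ :=
  (1 / ((m : ℝ) + 1)) * ∑ k ∈ Finset.range (m + 1), a n k

/-- The Riesz means `R_n(f;x) = (1/P_n) ∑_{k=0}^n p_k S_k(f;x)` with weights `w`. -/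
noncomputable def rieszMeans (w : ℕ → ℝ) (f : ℝ → ℝ) (n : ℕ) (x : ℝ) : ℝ :=
  (1 / (∑ k ∈ Finset.range (n + 1), w k)) *
    ∑ k ∈ Finset.range (n + 1), w k * partialFourierSum f k x

/-- The kernel `K_n(u) = ∑_{k=0}^n a_{n,k} sin((k+1/2)u)/(2 sin(u/2))`. -/
noncomputable def matrixKernel (a : ℕ → ℕ → ℝ) (n : ℕ) (u : ℝ) : ℝ :=
  ∑ k ∈ Finset.range (n + 1),
    a n k * (Real.sin (((k : ℝ) + 1 / 2) * u) / (2 * Real.sin (u / 2)))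

open scoped ENNReal

/-- Lebesgue measure on one period `(0, 2π]`. -/
noncomputable abbrev periodMeasure : Measure ℝ := volume.restrict (Set.Ioc 0 (2 * π))

lemma integrable_periodMeasure_of_continuous {E : Type*} [NormedAddCommGroup E]
    {g : ℝ → E} (hg : Continuous g) : Integrable g periodMeasure :=
  (hg.integrableOn_Icc (a := 0) (b := 2 * π)).mono_set Set.Ioc_subset_Icc_self

lemma lintegral_Ioc_periodic {g : ℝ → ℝ≥0∞} (hg : Function.Periodic g (2 * π)) (a b : ℝ) :
    ∫⁻ x in Set.Ioc a (a + 2 * π), g x = ∫⁻ x in Set.Ioc b (b + 2 * π), g x := by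
  have : VAddInvariantMeasure (AddSubgroup.zmultiples (2 * π)) ℝ volume :=
    ⟨fun c s _ => measure_preimage_add _ _ _⟩
  refine IsAddFundamentalDomain.setLIntegral_eq (G := AddSubgroup.zmultiples (2 * π))
    (isAddFundamentalDomain_Ioc two_pi_pos a) (isAddFundamentalDomain_Ioc two_pi_pos b) _
    hg.map_vadd_zmultiples

lemma lintegral_periodMeasure_comp_add {g : ℝ → ℝ≥0∞} (hg : Function.Periodic g (2 * π))
    (h : ℝ) : ∫⁻ x, g (x + h) ∂periodMeasure = ∫⁻ x, g x ∂periodMeasure := by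
  have h1 := (measurePreserving_add_right volume h).setLIntegral_comp_preimage_emb
    (measurableEmbedding_addRight h) g (Set.Ioc h (h + 2 * π))
  rw [lintegral_Ioc_periodic hg h 0] at h1
  simpa [add_comm, zero_add] using h1

/-- Minkowski's integral inequality for a family of functions in the unit ball of `L^p`. -/
lemma lintegral_rpow_lintegral_le {β γ : Type*} [MeasurableSpace β] [MeasurableSpace γ]
    {μ : Measure β} {ν : Measure γ} [SFinite μ] [SFinite ν] {p : ℝ} (hp : 1 < p)
    {Ψ : β → γ → ℝ≥0∞} (hΨ : AEMeasurable (Function.uncurry Ψ) (μ.prod ν))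
    (hle : ∀ᵐ u ∂ν, ∫⁻ x, Ψ x u ^ p ∂μ ≤ 1) :
    ∫⁻ x, (∫⁻ u, Ψ x u ∂ν) ^ p ∂μ ≤ ν Set.univ ^ p := by
  have hp0 : 0 < p := by linarith
  have hpq := Real.HolderConjugate.conjExponent hp
  set q := p.conjExponent
  have hq0 : 0 < q := hpq.symm.pos
  have hqp : 1 / q * p = p - 1 := by
    have := hpq.sub_one_mul_conj
    field_simp
    linarith
  have key : ∀ᵐ x ∂μ, (∫⁻ u, Ψ x u ∂ν) ^ p ≤ ν Set.univ ^ (p - 1) * ∫⁻ u, Ψ x u ^ p ∂ν := by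
    filter_upwards [hΨ.aestronglyMeasurable.prodMk_left] with x hx
    have := ENNReal.lintegral_mul_le_Lp_mul_Lq ν hpq hx.aemeasurable
      (aemeasurable_const (b := (1 : ℝ≥0∞)))
    simp only [Pi.mul_apply, Function.uncurry_apply_pair, mul_one, ENNReal.one_rpow,
      lintegral_const, one_mul] at this
    calc (∫⁻ u, Ψ x u ∂ν) ^ p
        ≤ ((∫⁻ u, Ψ x u ^ p ∂ν) ^ (1 / p) * ν Set.univ ^ (1 / q)) ^ p :=
          ENNReal.rpow_le_rpow this hp0.le
      _ = ν Set.univ ^ (p - 1) * ∫⁻ u, Ψ x u ^ p ∂ν := by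
          rw [ENNReal.mul_rpow_of_nonneg _ _ hp0.le, ← ENNReal.rpow_mul, ← ENNReal.rpow_mul, hqp,
            one_div_mul_cancel hp0.ne', ENNReal.rpow_one, mul_comm]
  calc ∫⁻ x, (∫⁻ u, Ψ x u ∂ν) ^ p ∂μ
      ≤ ∫⁻ x, ν Set.univ ^ (p - 1) * ∫⁻ u, Ψ x u ^ p ∂ν ∂μ := lintegral_mono_ae key
    _ = ν Set.univ ^ (p - 1) * ∫⁻ x, ∫⁻ u, Ψ x u ^ p ∂ν ∂μ :=
        lintegral_const_mul'' _ (hΨ.pow_const p).lintegral_prod_right'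
    _ = ν Set.univ ^ (p - 1) * ∫⁻ u, ∫⁻ x, Ψ x u ^ p ∂μ ∂ν := by
        rw [lintegral_lintegral_swap (hΨ.pow_const p)]
    _ ≤ ν Set.univ ^ (p - 1) * ∫⁻ _, 1 ∂ν := by
        refine mul_le_mul_right ?_ _
        exact lintegral_mono_ae hle
    _ = ν Set.univ ^ p := by
        rw [lintegral_const, one_mul]
        rcases eq_or_ne (ν Set.univ) 0 with h | h
        · simp [h, hp0]
        rcases eq_or_ne (ν Set.univ) ⊤ with h' | h'
        · rw [h', ENNReal.top_rpow_of_pos hp0, ENNReal.top_rpow_of_pos (by linarith)]; simp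
        conv_lhs => rw [← ENNReal.rpow_one (ν Set.univ), ← ENNReal.rpow_mul, one_mul,
          ← ENNReal.rpow_add _ _ h h']
        ring_nf

/-- Minkowski's integral inequality with a kernel `k` and a majorant `w` of the norms. -/
lemma eLpNorm_integral_mul_le {β γ : Type*} [MeasurableSpace β] [MeasurableSpace γ]
    {μ : Measure β} {ν : Measure γ} [SFinite μ] [SFinite ν] {p : ℝ} (hp : 1 < p)
    {k : γ → ℝ} (hk : Measurable k) {Φ : β → γ → ℝ}
    (hΦ : AEStronglyMeasurable (Function.uncurry Φ) (μ.prod ν))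
    {w : γ → ℝ≥0∞} (hw : Measurable w) (hw0 : ∀ᵐ u ∂ν, w u ≠ 0) (hwt : ∀ᵐ u ∂ν, w u ≠ ⊤)
    (hle : ∀ᵐ u ∂ν, eLpNorm (fun x => Φ x u) (ENNReal.ofReal p) μ ≤ w u) :
    eLpNorm (fun x => ∫ u, k u * Φ x u ∂ν) (ENNReal.ofReal p) μ ≤ ∫⁻ u, ‖k u‖ₑ * w u ∂ν := by
  have hp0 : 0 < p := by linarith
  have hpe0 : ENNReal.ofReal p ≠ 0 := by simpa using hp0
  have hpt : (ENNReal.ofReal p).toReal = p := ENNReal.toReal_ofReal hp0.le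
  have hd : Measurable fun u => ‖k u‖ₑ * w u := hk.enorm.mul hw
  set ν' := ν.withDensity fun u => ‖k u‖ₑ * w u with hν'
  have hac : ν' ≪ ν := withDensity_absolutelyContinuous _ _
  have huniv : ν' Set.univ = ∫⁻ u, ‖k u‖ₑ * w u ∂ν := by
    rw [hν', withDensity_apply _ MeasurableSet.univ, Measure.restrict_univ]
  have hmeas : AEMeasurable (Function.uncurry fun x u => ‖Φ x u‖ₑ / w u) (μ.prod ν) :=
    hΦ.enorm.div (hw.comp measurable_snd).aemeasurable
  have hB := lintegral_rpow_lintegral_le (μ := μ) (ν := ν') hp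
    (Ψ := fun x u => ‖Φ x u‖ₑ / w u)
    (hmeas.mono_ac (Measure.AbsolutelyContinuous.rfl.prod hac)) (by
      filter_upwards [hac hle, hac hw0, hac hwt] with u h1 h2 h3
      rw [eLpNorm_eq_lintegral_rpow_enorm_toReal hpe0 ENNReal.ofReal_ne_top, hpt] at h1
      simp_rw [ENNReal.div_rpow_of_nonneg _ _ hp0.le, div_eq_mul_inv]
      rw [lintegral_mul_const' _ _ (by simp [h2, hp0.le]), ← div_eq_mul_inv]
      refine ENNReal.div_le_of_le_mul ?_
      rw [one_mul]
      calc _ = ((∫⁻ x, ‖Φ x u‖ₑ ^ p ∂μ) ^ (1 / p)) ^ p := by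
            rw [← ENNReal.rpow_mul, one_div_mul_cancel hp0.ne', ENNReal.rpow_one]
        _ ≤ _ := ENNReal.rpow_le_rpow h1 hp0.le)
  rw [← huniv, eLpNorm_eq_lintegral_rpow_enorm_toReal hpe0 ENNReal.ofReal_ne_top, hpt]
  calc _ ≤ (∫⁻ x, (∫⁻ u, ‖Φ x u‖ₑ / w u ∂ν') ^ p ∂μ) ^ (1 / p) := by
        refine ENNReal.rpow_le_rpow (lintegral_mono_ae ?_) (by positivity)
        filter_upwards [hmeas.aestronglyMeasurable.prodMk_left] with x hx
        simp only [Function.uncurry_apply_pair] at hx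
        refine ENNReal.rpow_le_rpow ?_ hp0.le
        rw [hν', lintegral_withDensity_eq_lintegral_mul₀ hd.aemeasurable hx.aemeasurable]
        refine (enorm_integral_le_lintegral_enorm _).trans (lintegral_mono_ae ?_)
        filter_upwards [hw0, hwt] with u h2 h3
        simp only [enorm_mul, Pi.mul_apply]
        rw [mul_assoc, ENNReal.mul_div_cancel h2 h3]
    _ ≤ (ν' Set.univ ^ p) ^ (1 / p) := ENNReal.rpow_le_rpow hB (by positivity)
    _ = _ := by rw [← ENNReal.rpow_mul, mul_one_div_cancel hp0.ne', ENNReal.rpow_one]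

lemma eLpNorm_periodMeasure_comp_add {E : Type*} [NormedAddCommGroup E] {g : ℝ → E}
    (hg : Function.Periodic g (2 * π)) {p : ℝ} (hp : 0 < p) (h : ℝ) :
    eLpNorm (fun x => g (x + h)) (ENNReal.ofReal p) periodMeasure =
      eLpNorm g (ENNReal.ofReal p) periodMeasure := by
  have hpe0 : ENNReal.ofReal p ≠ 0 := by simpa using hp
  simp_rw [eLpNorm_eq_lintegral_rpow_enorm_toReal hpe0 ENNReal.ofReal_ne_top]
  rw [lintegral_periodMeasure_comp_add (g := fun x => ‖g x‖ₑ ^ (ENNReal.ofReal p).toReal)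
    (fun x => by simp only [hg x])]

lemma aestronglyMeasurable_prod_comp_sub {E : Type*} [NormedAddCommGroup E] {g : ℝ → E}
    (hg : AEStronglyMeasurable g volume) {μ ν : Measure ℝ} [SFinite μ] [SFinite ν]
    (hμ : μ ≪ volume) (hν : ν ≪ volume) :
    AEStronglyMeasurable (Function.uncurry fun x u => g (x - u)) (μ.prod ν) := by
  have := hg.comp_quasiMeasurePreserving
    (quasiMeasurePreserving_sub (volume : Measure ℝ) (volume : Measure ℝ))
  exact this.mono_ac (hμ.prod hν)

/-- Young's inequality for periodic convolution. -/
lemma eLpNorm_convolution_le {p : ℝ} (hp : 1 < p) {k : ℝ → ℝ} (hk : Continuous k)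
    {g : ℝ → ℝ} (hper : Function.Periodic g (2 * π)) (hg : AEStronglyMeasurable g volume) :
    eLpNorm (fun x => ∫ u, k u * g (x - u) ∂periodMeasure) (ENNReal.ofReal p) periodMeasure ≤
      (∫⁻ u, ‖k u‖ₑ ∂periodMeasure) * eLpNorm g (ENNReal.ofReal p) periodMeasure := by
  have hnorm : ∀ u, eLpNorm (fun x => g (x - u)) (ENNReal.ofReal p) periodMeasure =
      eLpNorm g (ENNReal.ofReal p) periodMeasure := fun u => by
    simpa only [sub_eq_add_neg] using eLpNorm_periodMeasure_comp_add hper (by linarith) (-u)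
  have hkfin : ∫⁻ u, ‖k u‖ₑ ∂periodMeasure ≠ ⊤ :=
    (integrable_periodMeasure_of_continuous hk).2.ne
  rcases eq_or_ne (eLpNorm g (ENNReal.ofReal p) periodMeasure) ⊤ with htop | htop
  · rcases eq_or_ne (∫⁻ u, ‖k u‖ₑ ∂periodMeasure) 0 with hk0 | hk0
    · rw [lintegral_eq_zero_iff hk.measurable.enorm] at hk0
      have : ∀ x, ∫ u, k u * g (x - u) ∂periodMeasure = 0 := fun x =>
        integral_eq_zero_of_ae <| by
          filter_upwards [hk0] with u hu
          have : k u = 0 := by simpa using hu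
          simp [this]
      simp [this]
    · rw [htop, ENNReal.mul_top hk0]; exact le_top
  refine ENNReal.le_of_forall_pos_le_add fun ε hε _ => ?_
  set c := ∫⁻ u, ‖k u‖ₑ ∂periodMeasure
  obtain ⟨δ, hδ0, hδ⟩ : ∃ δ : NNReal, 0 < δ ∧ c * δ ≤ ε := by
    clear_value c
    lift c to NNReal using hkfin
    refine ⟨ε / (c + 1), by positivity, ?_⟩
    rw [← ENNReal.coe_mul, ENNReal.coe_le_coe]
    have : c * (ε / (c + 1)) = ε * (c / (c + 1)) := by ring
    rw [this]
    exact mul_le_of_le_one_right zero_le (div_le_one_of_le₀ (by simp) (by positivity))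
  calc _ ≤ ∫⁻ u, ‖k u‖ₑ * (eLpNorm g (ENNReal.ofReal p) periodMeasure + δ) ∂periodMeasure := by
        refine eLpNorm_integral_mul_le hp hk.measurable
          (aestronglyMeasurable_prod_comp_sub hg Measure.absolutelyContinuous_restrict
            Measure.absolutelyContinuous_restrict) measurable_const ?_ ?_ ?_
        · exact .of_forall fun _ => by simp [hδ0.ne']
        · exact .of_forall fun _ => by simp [htop]
        · exact .of_forall fun u => by rw [hnorm u]; exact le_self_add
    _ = c * (eLpNorm g (ENNReal.ofReal p) periodMeasure + δ) :=
        lintegral_mul_const _ hk.measurable.enorm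
    _ ≤ _ := by rw [mul_add]; gcongr

/-- For `1 < p ≤ 2` the function `|z|^p` on the right half-plane is dominated by
`A (Re z)^p` minus a multiple of the harmonic function `Re (z^p)`. -/
lemma exists_norm_rpow_le_re_rpow_sub {p : ℝ} (hp : 1 < p) (hp2 : p ≤ 2) :
    ∃ A B : ℝ, 0 ≤ A ∧ 0 ≤ B ∧ ∀ z : ℂ, 0 < z.re →
      ‖z‖ ^ p ≤ A * z.re ^ p - B * (z ^ (p : ℂ)).re := by
  have hp0 : 0 < p := by linarith
  have hπ := pi_pos
  set c := -cos ((p + 1) * π / 4) with hc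
  have hc0 : 0 < c := by
    rw [hc, neg_pos]
    apply cos_neg_of_pi_div_two_lt_of_lt <;> nlinarith
  set φ := (p + 1) * π / (4 * p) with hφ
  have hpφ : p * φ = (p + 1) * π / 4 := by rw [hφ]; field_simp
  have hφ0 : 0 < φ := by positivity
  have hφ1 : φ < π / 2 := by
    have : p * φ < p * (π / 2) := by rw [hpφ]; nlinarith
    exact lt_of_mul_lt_mul_left this hp0.le
  have hcosφ : 0 < cos φ := cos_pos_of_mem_Ioo ⟨by linarith, hφ1⟩
  refine ⟨(1 + 1 / c) / cos φ ^ p, 1 / c, by positivity, by positivity, fun z hz => ?_⟩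
  have hz0 : z ≠ 0 := by rintro rfl; simp at hz
  have hn : 0 < ‖z‖ := norm_pos_iff.mpr hz0
  have hre : z.re = ‖z‖ * cos z.arg := (Complex.norm_mul_cos_arg z).symm
  have hpow : (z ^ (p : ℂ)).re = ‖z‖ ^ p * cos (p * z.arg) := by
    rw [Complex.cpow_ofReal_re, mul_comm z.arg]
  have harg : |z.arg| < π / 2 := Complex.abs_arg_lt_pi_div_two_iff.mpr (Or.inl hz)
  have hcosarg : 0 < cos z.arg := by
    rw [hre] at hz; exact pos_of_mul_pos_right hz hn.le
  rw [hpow, hre, mul_rpow hn.le hcosarg.le]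
  have habs : cos (p * z.arg) = cos (p * |z.arg|) := by
    rw [← cos_abs (p * z.arg), abs_mul, abs_of_pos hp0]
  suffices h : 1 ≤ (1 + 1 / c) / cos φ ^ p * cos z.arg ^ p - 1 / c * cos (p * z.arg) by
    have := mul_le_mul_of_nonneg_left h (rpow_nonneg hn.le p)
    linarith
  rcases le_total |z.arg| φ with h | h
  · have h1 : cos φ ≤ cos z.arg := by
      rw [← cos_abs z.arg]
      exact cos_le_cos_of_nonneg_of_le_pi (abs_nonneg _) (by linarith) h
    have h2 : cos φ ^ p ≤ cos z.arg ^ p := rpow_le_rpow hcosφ.le h1 hp0.le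
    have h3 : 1 + 1 / c ≤ (1 + 1 / c) / cos φ ^ p * cos z.arg ^ p := by
      rw [div_mul_eq_mul_div, le_div_iff₀ (by positivity)]
      gcongr
    have h4 : 1 / c * cos (p * z.arg) ≤ 1 / c :=
      mul_le_of_le_one_right (by positivity) (cos_le_one _)
    linarith
  · have h1 : cos (p * |z.arg|) ≤ -c := by
      rw [hc, neg_neg]
      refine cos_le_cos_of_nonneg_of_le_pi (by positivity) ?_ ?_
      · nlinarith [abs_nonneg z.arg]
      · rw [← hpφ]; gcongr
    have h3 : 0 ≤ (1 + 1 / c) / cos φ ^ p * cos z.arg ^ p := by positivity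
    have h4 : 1 / c * cos (p * z.arg) ≤ 1 / c * -c := by rw [habs]; gcongr
    have h5 : 1 / c * -c = -1 := by field_simp
    linarith

/-- The Cauchy integral of a function on the circle. -/
noncomputable def cauchyTransform (g : ℝ → ℝ) (z : ℂ) : ℂ :=
  ∫ t, (g t : ℂ) * (1 - z * Complex.exp (-(t * Complex.I)))⁻¹ ∂periodMeasure

lemma norm_mul_exp_neg_mul_I (z : ℂ) (t : ℝ) :
    ‖z * Complex.exp (-(t * Complex.I))‖ = ‖z‖ := by
  rw [norm_mul, ← neg_mul, ← Complex.ofReal_neg, Complex.norm_exp_ofReal_mul_I, mul_one]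

lemma one_sub_norm_le_norm_one_sub (w : ℂ) : 1 - ‖w‖ ≤ ‖1 - w‖ := by
  simpa using norm_sub_norm_le (1 : ℂ) w

lemma one_sub_ne_zero_of_norm_lt_one {w : ℂ} (hw : ‖w‖ < 1) : 1 - w ≠ 0 := by
  rw [← norm_pos_iff]; linarith [one_sub_norm_le_norm_one_sub w]

lemma half_le_re_inv_one_sub {w : ℂ} (hw : ‖w‖ < 1) : 1 / 2 ≤ ((1 - w)⁻¹).re := by
  have h0 : 0 < Complex.normSq (1 - w) :=
    Complex.normSq_pos.mpr (one_sub_ne_zero_of_norm_lt_one hw)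
  have h1 : Complex.normSq w < 1 := by
    rw [Complex.normSq_eq_norm_sq]; nlinarith [norm_nonneg w]
  rw [Complex.inv_re, le_div_iff₀ h0]
  simp only [Complex.normSq_apply, Complex.sub_re, Complex.sub_im, Complex.one_re,
    Complex.one_im] at *
  nlinarith

lemma continuous_inv_one_sub_mul_exp {z : ℂ} (hz : ‖z‖ < 1) :
    Continuous fun t : ℝ => (1 - z * Complex.exp (-(t * Complex.I)))⁻¹ := by
  refine Continuous.inv₀ (by fun_prop) fun t => one_sub_ne_zero_of_norm_lt_one ?_
  rwa [norm_mul_exp_neg_mul_I]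

lemma integrable_cauchyTransform {g : ℝ → ℝ} (hg : Integrable g periodMeasure) {z : ℂ}
    (hz : ‖z‖ < 1) :
    Integrable (fun t : ℝ => (g t : ℂ) * (1 - z * Complex.exp (-(t * Complex.I)))⁻¹)
      periodMeasure := by
  refine hg.ofReal.mul_bdd (c := (1 - ‖z‖)⁻¹)
    (continuous_inv_one_sub_mul_exp hz).aestronglyMeasurable (.of_forall fun t => ?_)
  rw [norm_inv]
  refine inv_anti₀ (by linarith) ?_
  simpa only [norm_mul_exp_neg_mul_I] using
    one_sub_norm_le_norm_one_sub (z * Complex.exp (-(t * Complex.I)))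

lemma cauchyTransform_re {g : ℝ → ℝ} (hg : Integrable g periodMeasure) {z : ℂ}
    (hz : ‖z‖ < 1) :
    (cauchyTransform g z).re =
      ∫ t, g t * ((1 - z * Complex.exp (-(t * Complex.I)))⁻¹).re ∂periodMeasure := by
  have := integral_re (integrable_cauchyTransform hg hz)
  simp only [RCLike.re_to_complex, Complex.re_ofReal_mul] at this
  rw [this]; rfl

lemma cauchyTransform_zero (g : ℝ → ℝ) :
    cauchyTransform g 0 = ((∫ t, g t ∂periodMeasure : ℝ) : ℂ) := by
  simp [cauchyTransform, integral_complex_ofReal]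

lemma half_integral_le_cauchyTransform_re {g : ℝ → ℝ} (hg : Integrable g periodMeasure)
    (hg0 : ∀ t, 0 ≤ g t) {z : ℂ} (hz : ‖z‖ < 1) :
    1 / 2 * ∫ t, g t ∂periodMeasure ≤ (cauchyTransform g z).re := by
  rw [cauchyTransform_re hg hz, ← integral_const_mul]
  refine integral_mono (hg.const_mul _) ?_ fun t => ?_
  · simpa only [RCLike.re_to_complex, Complex.re_ofReal_mul] using
      (integrable_cauchyTransform hg hz).re
  · simp only
    rw [mul_comm]
    refine mul_le_mul_of_nonneg_left (half_le_re_inv_one_sub ?_) (hg0 t)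
    rwa [norm_mul_exp_neg_mul_I]

lemma differentiableAt_cauchyTransform {g : ℝ → ℝ} (hg : Integrable g periodMeasure) {z : ℂ}
    (hz : ‖z‖ < 1) : DifferentiableAt ℂ (cauchyTransform g) z := by
  obtain ⟨ρ, hzρ, hρ⟩ := exists_between hz
  have hnorm : ∀ w ∈ Metric.ball (0 : ℂ) ρ, ∀ t : ℝ,
      1 - ρ ≤ ‖1 - w * Complex.exp (-(t * Complex.I))‖ := fun w hw t => by
    have h1 := one_sub_norm_le_norm_one_sub (w * Complex.exp (-(t * Complex.I)))
    rw [norm_mul_exp_neg_mul_I] at h1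
    have : ‖w‖ < ρ := by simpa using hw
    linarith
  refine (hasDerivAt_integral_of_dominated_loc_of_deriv_le (𝕜 := ℂ)
    (F := fun w t => (g t : ℂ) * (1 - w * Complex.exp (-(t * Complex.I)))⁻¹)
    (F' := fun w t => (g t : ℂ) * (Complex.exp (-(t * Complex.I)) /
      (1 - w * Complex.exp (-(t * Complex.I))) ^ 2))
    (s := Metric.ball 0 ρ) (bound := fun t => |g t| * ((1 - ρ) ^ 2)⁻¹)
    (Metric.isOpen_ball.mem_nhds (by simpa using hzρ)) ?_ (integrable_cauchyTransform hg hz) ?_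
    (.of_forall fun t w hw => ?_) (hg.abs.mul_const _)
    (.of_forall fun t w hw => ?_)).2.differentiableAt
  · filter_upwards [Metric.isOpen_ball.mem_nhds (x := z) (s := Metric.ball 0 1)
      (by simpa using hz)] with w hw
    exact (integrable_cauchyTransform hg (by simpa using hw)).aestronglyMeasurable
  · refine hg.ofReal.aestronglyMeasurable.mul (Continuous.aestronglyMeasurable ?_)
    refine Continuous.div (by fun_prop) (by fun_prop) fun t => pow_ne_zero _ ?_
    exact one_sub_ne_zero_of_norm_lt_one (by rwa [norm_mul_exp_neg_mul_I])
  · rw [norm_mul, Complex.norm_real, norm_div, norm_pow, Real.norm_eq_abs]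
    have := norm_mul_exp_neg_mul_I 1 t
    rw [one_mul, norm_one] at this
    rw [this, one_div]
    gcongr
    exact hnorm w hw t
  · have hne : 1 - w * Complex.exp (-(t * Complex.I)) ≠ 0 := by
      rw [← norm_pos_iff]; linarith [hnorm w hw t]
    have h1 : HasDerivAt (fun w : ℂ => 1 - w * Complex.exp (-(t * Complex.I)))
        (-(1 * Complex.exp (-(t * Complex.I)))) w :=
      ((hasDerivAt_id w).mul_const _).const_sub 1
    have h2 := (h1.inv hne).const_mul (g t : ℂ)
    simpa using h2

lemma integral_periodMeasure_eq {E : Type*} [NormedAddCommGroup E] [NormedSpace ℝ E]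
    (g : ℝ → E) : ∫ t, g t ∂periodMeasure = ∫ t in (0 : ℝ)..2 * π, g t :=
  (intervalIntegral.integral_of_le two_pi_pos.le).symm

lemma integral_periodMeasure_comp_sub_left {E : Type*} [NormedAddCommGroup E] [NormedSpace ℝ E]
    {g : ℝ → E} (hg : Function.Periodic g (2 * π)) (x : ℝ) :
    ∫ t, g (x - t) ∂periodMeasure = ∫ t, g t ∂periodMeasure := by
  rw [integral_periodMeasure_eq, integral_periodMeasure_eq,
    intervalIntegral.integral_comp_sub_left g x]
  have := hg.intervalIntegral_add_eq (x - 2 * π) 0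
  simpa using this

lemma circleMap_mul_exp_neg (r x t : ℝ) :
    circleMap 0 r x * Complex.exp (-(t * Complex.I)) = circleMap 0 r (x - t) := by
  simp only [circleMap, zero_add]
  rw [mul_assoc, ← Complex.exp_add]
  push_cast
  ring_nf

lemma norm_circleMap_lt_one {r : ℝ} (hr0 : 0 ≤ r) (hr1 : r < 1) (x : ℝ) :
    ‖circleMap 0 r x‖ < 1 := by
  rwa [norm_circleMap_zero, abs_of_nonneg hr0]

/-- The real part of the Cauchy kernel on the circle of radius `r`. -/
noncomputable def cauchyKernelRe (r u : ℝ) : ℝ := ((1 - circleMap 0 r u)⁻¹).re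

lemma cauchyKernelRe_pos {r : ℝ} (hr0 : 0 ≤ r) (hr1 : r < 1) (u : ℝ) :
    0 < cauchyKernelRe r u :=
  lt_of_lt_of_le (by norm_num) (half_le_re_inv_one_sub (norm_circleMap_lt_one hr0 hr1 u))

lemma continuous_cauchyKernelRe {r : ℝ} (hr0 : 0 ≤ r) (hr1 : r < 1) :
    Continuous (cauchyKernelRe r) := by
  refine Complex.continuous_re.comp (Continuous.inv₀ (by fun_prop) fun t => ?_)
  exact one_sub_ne_zero_of_norm_lt_one (norm_circleMap_lt_one hr0 hr1 t)

lemma integral_comp_circleMap {F : ℂ → ℂ} {r : ℝ} (hr0 : 0 ≤ r)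
    (hF : DifferentiableOn ℂ F (Metric.closedBall 0 r)) :
    ∫ x, F (circleMap 0 r x) ∂periodMeasure = 2 * π * F 0 := by
  have h1 : DiffContOnCl ℂ F (Metric.ball 0 |r|) := by
    refine DifferentiableOn.diffContOnCl (hF.mono ?_)
    rw [abs_of_nonneg hr0]
    exact Metric.closure_ball_subset_closedBall
  have h2 := h1.circleAverage
  rw [Real.circleAverage_def, ← integral_periodMeasure_eq] at h2
  rw [← h2, Complex.real_smul]
  push_cast
  have : (π : ℂ) ≠ 0 := by exact_mod_cast pi_ne_zero
  field_simp

lemma lintegral_cauchyKernelRe {r : ℝ} (hr0 : 0 ≤ r) (hr1 : r < 1) :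
    ∫⁻ u, ‖cauchyKernelRe r u‖ₑ ∂periodMeasure = ENNReal.ofReal (2 * π) := by
  have hcauchy : Integrable (fun u => (1 - circleMap 0 r u)⁻¹) periodMeasure := by
    refine integrable_periodMeasure_of_continuous ?_
    refine Continuous.inv₀ (by fun_prop) fun t => ?_
    exact one_sub_ne_zero_of_norm_lt_one (norm_circleMap_lt_one hr0 hr1 t)
  have hmean := integral_comp_circleMap (F := fun z => (1 - z)⁻¹) hr0 (by
    refine DifferentiableOn.inv (by fun_prop) fun z hz => one_sub_ne_zero_of_norm_lt_one ?_
    exact lt_of_le_of_lt (by simpa using hz) hr1)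
  have hre : ∫ u, cauchyKernelRe r u ∂periodMeasure = 2 * π := by
    have := integral_re hcauchy
    simp only [RCLike.re_to_complex] at this
    rw [hmean] at this
    simpa [cauchyKernelRe] using this
  rw [← ofReal_integral_norm_eq_lintegral_enorm
    (integrable_periodMeasure_of_continuous (continuous_cauchyKernelRe hr0 hr1)), ← hre]
  congr 1
  exact integral_congr_ae (.of_forall fun u => abs_of_pos (cauchyKernelRe_pos hr0 hr1 u))

lemma eLpNorm_cauchyTransform_re_le {p : ℝ} (hp : 1 < p) {g : ℝ → ℝ}
    (hper : Function.Periodic g (2 * π)) (hg : AEStronglyMeasurable g volume)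
    (hgi : Integrable g periodMeasure) {r : ℝ} (hr0 : 0 ≤ r) (hr1 : r < 1) :
    eLpNorm (fun x => (cauchyTransform g (circleMap 0 r x)).re) (ENNReal.ofReal p) periodMeasure ≤
      ENNReal.ofReal (2 * π) * eLpNorm g (ENNReal.ofReal p) periodMeasure := by
  rw [← lintegral_cauchyKernelRe hr0 hr1]
  refine le_trans (le_of_eq ?_)
    (eLpNorm_convolution_le hp (continuous_cauchyKernelRe hr0 hr1) hper hg)
  congr 1
  ext x
  rw [cauchyTransform_re hgi (norm_circleMap_lt_one hr0 hr1 x)]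
  simp_rw [circleMap_mul_exp_neg]
  have hH : Function.Periodic (fun t => g t * cauchyKernelRe r (x - t)) (2 * π) := fun t => by
    simp only [hper t, cauchyKernelRe, ← sub_sub, (periodic_circleMap 0 r).sub_eq]
  refine (integral_periodMeasure_comp_sub_left hH x).symm.trans ?_
  simp only [sub_sub_cancel, mul_comm]

lemma continuous_cauchyTransform_circleMap {g : ℝ → ℝ} (hg : Integrable g periodMeasure) {r : ℝ}
    (hr0 : 0 ≤ r) (hr1 : r < 1) : Continuous fun x => cauchyTransform g (circleMap 0 r x) := by
  refine continuous_iff_continuousAt.mpr fun x => ContinuousAt.comp (g := cauchyTransform g) ?_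
    (continuous_circleMap 0 r).continuousAt
  exact (differentiableAt_cauchyTransform hg (norm_circleMap_lt_one hr0 hr1 x)).continuousAt

/-- The `L^p` bound for the Cauchy transform of a nonnegative function, `1 < p ≤ 2`. -/
lemma exists_eLpNorm_cauchyTransform_nonneg_le {p : ℝ} (hp : 1 < p) (hp2 : p ≤ 2) :
    ∃ C : NNReal, ∀ g : ℝ → ℝ, Function.Periodic g (2 * π) → AEStronglyMeasurable g volume →
      Integrable g periodMeasure → (∀ t, 0 ≤ g t) → ∀ r : ℝ, 0 ≤ r → r < 1 →
      eLpNorm (fun x => cauchyTransform g (circleMap 0 r x)) (ENNReal.ofReal p) periodMeasure ≤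
        C * eLpNorm g (ENNReal.ofReal p) periodMeasure := by
  obtain ⟨A, B, hA, hB, hAB⟩ := exists_norm_rpow_le_re_rpow_sub hp hp2
  have hp0 : 0 < p := by linarith
  have hpe0 : ENNReal.ofReal p ≠ 0 := by simpa using hp0
  have hpt : (ENNReal.ofReal p).toReal = p := ENNReal.toReal_ofReal hp0.le
  refine ⟨(A ^ (1 / p)).toNNReal * (2 * π).toNNReal, fun g hper hg hgi hg0 r hr0 hr1 => ?_⟩
  set F := fun x => cauchyTransform g (circleMap 0 r x) with hF
  have hFc : Continuous F := continuous_cauchyTransform_circleMap hgi hr0 hr1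
  suffices h : eLpNorm F (ENNReal.ofReal p) periodMeasure ≤
      ENNReal.ofReal (A ^ (1 / p)) *
        eLpNorm (fun x => (F x).re) (ENNReal.ofReal p) periodMeasure by
    refine h.trans ?_
    rw [ENNReal.coe_mul, mul_assoc]
    exact mul_le_mul_right (eLpNorm_cauchyTransform_re_le hp hper hg hgi hr0 hr1) _
  rcases (integral_nonneg hg0 : 0 ≤ ∫ t, g t ∂periodMeasure).eq_or_lt with h0 | h0
  · have hz : g =ᵐ[periodMeasure] 0 := (integral_eq_zero_iff_of_nonneg hg0 hgi).mp h0.symm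
    have : F = fun _ => 0 := by
      ext x
      refine integral_eq_zero_of_ae ?_
      filter_upwards [hz] with t ht
      simp [ht]
    simp [this]
  have hpos : ∀ z : ℂ, ‖z‖ < 1 → 0 < (cauchyTransform g z).re := fun z hz =>
    lt_of_lt_of_le (by positivity) (half_integral_le_cauchyTransform_re hgi hg0 hz)
  have hposF : ∀ x, 0 < (F x).re := fun x => hpos _ (norm_circleMap_lt_one hr0 hr1 x)
  have hpowc : Continuous fun x => F x ^ (p : ℂ) :=
    hFc.cpow continuous_const fun x => Or.inl (hposF x)
  have hmean : 0 ≤ ∫ x, (F x ^ (p : ℂ)).re ∂periodMeasure := by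
    have h1 := integral_comp_circleMap (F := fun z => cauchyTransform g z ^ (p : ℂ)) hr0 (by
      intro z hz
      have hz1 : ‖z‖ < 1 := lt_of_le_of_lt (by simpa using hz) hr1
      exact ((differentiableAt_cauchyTransform hgi hz1).cpow_const
        (Or.inl (hpos z hz1))).differentiableWithinAt)
    have h2 := integral_re (integrable_periodMeasure_of_continuous hpowc)
    simp only [RCLike.re_to_complex] at h2
    rw [h2, h1, cauchyTransform_zero, ← Complex.ofReal_cpow h0.le]
    have : (2 * (π : ℂ) * (((∫ t, g t ∂periodMeasure) ^ p : ℝ) : ℂ)).re =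
        2 * π * (∫ t, g t ∂periodMeasure) ^ p := by
      rw [← Complex.ofReal_ofNat, ← Complex.ofReal_mul, ← Complex.ofReal_mul, Complex.ofReal_re]
    rw [this]
    positivity
  have hpowre_c : Continuous fun x => (F x ^ (p : ℂ)).re := Complex.continuous_re.comp hpowc
  have hre_c : Continuous fun x => (F x).re ^ p :=
    (Complex.continuous_re.comp hFc).rpow_const fun x => Or.inr hp0.le
  have hnorm_c : Continuous fun x => ‖F x‖ ^ p := hFc.norm.rpow_const fun x => Or.inr hp0.le
  have hmain : ∫ x, ‖F x‖ ^ p ∂periodMeasure ≤ A * ∫ x, (F x).re ^ p ∂periodMeasure := by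
    calc ∫ x, ‖F x‖ ^ p ∂periodMeasure
        ≤ ∫ x, (A * (F x).re ^ p - B * (F x ^ (p : ℂ)).re) ∂periodMeasure :=
          integral_mono (integrable_periodMeasure_of_continuous hnorm_c)
            (integrable_periodMeasure_of_continuous ((hre_c.const_mul A).sub
              (hpowre_c.const_mul B))) fun x => hAB _ (hposF x)
      _ = A * ∫ x, (F x).re ^ p ∂periodMeasure -
            B * ∫ x, (F x ^ (p : ℂ)).re ∂periodMeasure := by
          rw [integral_sub (integrable_periodMeasure_of_continuous (hre_c.const_mul A))
            (integrable_periodMeasure_of_continuous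
              (hpowre_c.const_mul B)),
            integral_const_mul, integral_const_mul]
      _ ≤ _ := by nlinarith
  have e1 : ∫⁻ x, ‖F x‖ₑ ^ p ∂periodMeasure = ENNReal.ofReal (∫ x, ‖F x‖ ^ p ∂periodMeasure) := by
    rw [ofReal_integral_eq_lintegral_ofReal (integrable_periodMeasure_of_continuous hnorm_c)
      (.of_forall fun x => by positivity)]
    refine lintegral_congr fun x => ?_
    rw [← ENNReal.ofReal_rpow_of_nonneg (norm_nonneg _) hp0.le, ofReal_norm]
  have e2 : ∫⁻ x, ‖(F x).re‖ₑ ^ p ∂periodMeasure =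
      ENNReal.ofReal (∫ x, (F x).re ^ p ∂periodMeasure) := by
    rw [ofReal_integral_eq_lintegral_ofReal (integrable_periodMeasure_of_continuous hre_c)
      (.of_forall fun x => (rpow_pos_of_pos (hposF x) p).le)]
    refine lintegral_congr fun x => ?_
    rw [← ENNReal.ofReal_rpow_of_nonneg (hposF x).le hp0.le, ← ofReal_norm,
      Real.norm_of_nonneg (hposF x).le]
  simp_rw [eLpNorm_eq_lintegral_rpow_enorm_toReal hpe0 ENNReal.ofReal_ne_top, hpt]
  rw [e1, e2, ← ENNReal.ofReal_rpow_of_nonneg hA (by positivity),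
    ← ENNReal.mul_rpow_of_nonneg _ _ (by positivity : 0 ≤ 1 / p), ← ENNReal.ofReal_mul hA]
  exact ENNReal.rpow_le_rpow (ENNReal.ofReal_le_ofReal hmain) (by positivity)

lemma MeasureTheory.Integrable.mul_continuous_periodMeasure {f : ℝ → ℝ}
    (hf : Integrable f periodMeasure) {k : ℝ → ℝ} (hk : Continuous k) : Integrable (fun t => f t * k t) periodMeasure := by
  obtain ⟨c, hc⟩ := isCompact_Icc.exists_bound_of_continuousOn (s := Set.Icc 0 (2 * π))
    hk.continuousOn
  refine hf.mul_bdd (c := c) hk.aestronglyMeasurable ?_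
  filter_upwards [ae_restrict_mem measurableSet_Ioc] with t ht
  exact hc t (Set.Ioc_subset_Icc_self ht)

lemma continuous_dirichletKernel (n : ℕ) : Continuous (dirichletKernel n) := by
  unfold dirichletKernel; fun_prop

lemma partialFourierSum_eq (f : ℝ → ℝ) (n : ℕ) (x : ℝ) :
    partialFourierSum f n x = 1 / π * ∫ t, f t * dirichletKernel n (x - t) ∂periodMeasure := by
  rw [partialFourierSum, integral_periodMeasure_eq]

lemma partialFourierSum_eq_trig {f : ℝ → ℝ} (hf : Integrable f periodMeasure) (n : ℕ) (x : ℝ) :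
    partialFourierSum f n x = 1 / π * ((∫ t, f t ∂periodMeasure) * (1 / 2) +
      ∑ k ∈ Finset.Icc 1 n, ((∫ t, f t * cos (k * t) ∂periodMeasure) * cos (k * x) +
        (∫ t, f t * sin (k * t) ∂periodMeasure) * sin (k * x))) := by
  have hcos : ∀ k : ℕ, Integrable (fun t => f t * cos (k * t)) periodMeasure := fun k =>
    hf.mul_continuous_periodMeasure (by fun_prop)
  have hsin : ∀ k : ℕ, Integrable (fun t => f t * sin (k * t)) periodMeasure := fun k =>
    hf.mul_continuous_periodMeasure (by fun_prop)
  rw [partialFourierSum_eq]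
  congr 1
  have hpt : ∀ t, f t * dirichletKernel n (x - t) = f t * (1 / 2) +
      ∑ k ∈ Finset.Icc 1 n, (f t * cos (k * t) * cos (k * x) + f t * sin (k * t) * sin (k * x)) :=
    fun t => by
      rw [dirichletKernel, mul_add, mul_sum]
      congr 1
      refine sum_congr rfl fun k _ => ?_
      rw [mul_sub, cos_sub]; ring
  simp_rw [hpt]
  rw [integral_add (hf.mul_const _)
    (integrable_finsetSum _ fun k _ => ((hcos k).mul_const _).fun_add ((hsin k).mul_const _)),
    integral_mul_const, integral_finsetSum _
      fun k _ => ((hcos k).mul_const _).fun_add ((hsin k).mul_const _)]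
  congr 1
  refine sum_congr rfl fun k _ => ?_
  rw [integral_add ((hcos k).mul_const _) ((hsin k).mul_const _), integral_mul_const,
    integral_mul_const]

lemma continuous_partialFourierSum {f : ℝ → ℝ} (hf : Integrable f periodMeasure) (n : ℕ) :
    Continuous (partialFourierSum f n) := by
  rw [funext (partialFourierSum_eq_trig hf n)]
  fun_prop

lemma exp_mul_sum_exp_eq_dirichletKernel (n : ℕ) (u : ℝ) :
    Complex.exp (-(n * u * Complex.I)) * ∑ k ∈ range (2 * n + 1), circleMap 0 1 u ^ k =
      2 * (dirichletKernel n u : ℂ) := by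
  induction n with
  | zero => simp [dirichletKernel]
  | succ n ih =>
    have hD : (dirichletKernel (n + 1) u : ℂ) =
        dirichletKernel n u + Complex.cos ((n + 1 : ℂ) * u) := by
      unfold dirichletKernel
      rw [sum_Icc_succ_top (by omega)]
      push_cast
      ring
    have hsum : ∑ k ∈ range (2 * (n + 1) + 1), circleMap 0 1 u ^ k =
        1 + circleMap 0 1 u * ∑ k ∈ range (2 * n + 1), circleMap 0 1 u ^ k +
          circleMap 0 1 u ^ (2 * n + 2) := by
      rw [show 2 * (n + 1) + 1 = (2 * n + 1 + 1) + 1 by ring, sum_range_succ, sum_range_succ',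
        mul_sum]
      simp only [pow_succ, pow_zero]
      ring_nf
    have hw : circleMap 0 1 u = Complex.exp (u * Complex.I) := by simp [circleMap]
    rw [hD, hsum, mul_add 2, ← ih, Complex.two_cos, hw, ← Complex.exp_nat_mul]
    have e1 : Complex.exp (-((n + 1 : ℕ) * u * Complex.I)) * Complex.exp (u * Complex.I) =
        Complex.exp (-(n * u * Complex.I)) := by
      rw [← Complex.exp_add]; push_cast; ring_nf
    have e2 : Complex.exp (-((n + 1 : ℕ) * u * Complex.I)) *
        Complex.exp ((2 * n + 2 : ℕ) * (u * Complex.I)) =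
        Complex.exp ((n + 1) * u * Complex.I) := by
      rw [← Complex.exp_add]; push_cast; ring_nf
    rw [mul_add, mul_add, ← mul_assoc, e1, e2]
    push_cast
    ring_nf

/-- The `L^p` bound for the Cauchy transform of a real function, `1 < p ≤ 2`. -/
lemma exists_eLpNorm_cauchyTransform_le {p : ℝ} (hp : 1 < p) (hp2 : p ≤ 2) :
    ∃ C : NNReal, ∀ g : ℝ → ℝ, Function.Periodic g (2 * π) → AEStronglyMeasurable g volume →
      Integrable g periodMeasure → ∀ r : ℝ, 0 ≤ r → r < 1 →
      eLpNorm (fun x => cauchyTransform g (circleMap 0 r x)) (ENNReal.ofReal p) periodMeasure ≤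
        C * eLpNorm g (ENNReal.ofReal p) periodMeasure := by
  obtain ⟨C, hC⟩ := exists_eLpNorm_cauchyTransform_nonneg_le hp hp2
  have hp1 : 1 ≤ ENNReal.ofReal p := by simpa using hp.le
  refine ⟨2 * C, fun g hper hg hgi r hr0 hr1 => ?_⟩
  have hposi : Integrable (fun t => max (g t) 0) periodMeasure := hgi.pos_part
  have hnegi : Integrable (fun t => max (-g t) 0) periodMeasure := hgi.neg_part
  have hsplit : (fun x => cauchyTransform g (circleMap 0 r x)) =
      (fun x => cauchyTransform (fun t => max (g t) 0) (circleMap 0 r x)) -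
        fun x => cauchyTransform (fun t => max (-g t) 0) (circleMap 0 r x) := by
    ext x
    have hz := norm_circleMap_lt_one hr0 hr1 x
    simp only [cauchyTransform, Pi.sub_apply]
    rw [← integral_sub (integrable_cauchyTransform hposi hz) (integrable_cauchyTransform hnegi hz)]
    refine integral_congr_ae (.of_forall fun t => ?_)
    simp only
    rw [← sub_mul, ← Complex.ofReal_sub, 
      max_zero_sub_max_neg_zero_eq_self]
  rw [hsplit]
  refine (eLpNorm_sub_le (continuous_cauchyTransform_circleMap hposi hr0 hr1).aestronglyMeasurable
    (continuous_cauchyTransform_circleMap hnegi hr0 hr1).aestronglyMeasurable hp1).trans ?_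
  rw [ENNReal.coe_mul, ENNReal.coe_ofNat, two_mul, add_mul]
  refine add_le_add ?_ ?_
  · refine (hC _ (fun t => by simp [hper t]) (hg.sup aestronglyMeasurable_const) hposi
      (fun t => le_max_right _ _) r hr0 hr1).trans (mul_le_mul_right (eLpNorm_mono fun t => ?_) _)
    rw [Real.norm_eq_abs, Real.norm_eq_abs, abs_of_nonneg (le_max_right _ _)]
    exact max_le (le_abs_self _) (abs_nonneg _)
  · refine (hC _ (fun t => by simp [hper t]) (hg.neg.sup aestronglyMeasurable_const) hnegi
      (fun t => le_max_right _ _) r hr0 hr1).trans (mul_le_mul_right (eLpNorm_mono fun t => ?_) _)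
    rw [Real.norm_eq_abs, Real.norm_eq_abs, abs_of_nonneg (le_max_right _ _)]
    exact max_le (neg_le_abs _) (abs_nonneg _)

/-- Abel regularization of `2π` times the `n`-th Fourier partial sum. -/
noncomputable def abelPartialSum (f : ℝ → ℝ) (n : ℕ) (r x : ℝ) : ℂ :=
  ∫ t, (f t : ℂ) * (Complex.exp (-(n * (x - t : ℝ) * Complex.I)) *
    ∑ k ∈ range (2 * n + 1), circleMap 0 r (x - t) ^ k) ∂periodMeasure

lemma abelPartialSum_eq_cauchyTransform {f : ℝ → ℝ} (hf : Integrable f periodMeasure) (n : ℕ)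
    {r : ℝ} (hr0 : 0 ≤ r) (hr1 : r < 1) (x : ℝ) :
    abelPartialSum f n r x =
      Complex.exp (-(n * x : ℝ) * Complex.I) *
        (cauchyTransform (fun t => f t * cos (n * t)) (circleMap 0 r x) +
          Complex.I * cauchyTransform (fun t => f t * sin (n * t)) (circleMap 0 r x)) -
      (r : ℂ) ^ (2 * n + 1) * Complex.exp (((n + 1) * x : ℝ) * Complex.I) *
        (cauchyTransform (fun t => f t * cos ((n + 1) * t)) (circleMap 0 r x) -
          Complex.I * cauchyTransform (fun t => f t * sin ((n + 1) * t)) (circleMap 0 r x)) := by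
  have hz := norm_circleMap_lt_one hr0 hr1 x
  have hi : ∀ k : ℝ → ℝ, Continuous k → Integrable (fun t : ℝ => ((f t * k t : ℝ) : ℂ) *
      (1 - circleMap 0 r x * Complex.exp (-(t * Complex.I)))⁻¹) periodMeasure := fun k hk =>
    integrable_cauchyTransform (hf.mul_continuous_periodMeasure hk) hz
  have h1 := hi (fun t => cos (n * t)) (by fun_prop)
  have h2 := hi (fun t => sin (n * t)) (by fun_prop)
  have h3 := hi (fun t => cos ((n + 1) * t)) (by fun_prop)
  have h4 := hi (fun t => sin ((n + 1) * t)) (by fun_prop)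
  have h34 := h3.sub (h4.const_mul Complex.I)
  simp only [Pi.sub_def] at h34
  simp only [cauchyTransform, abelPartialSum]
  rw [← integral_const_mul, ← integral_const_mul, ← integral_add h1 (h2.const_mul _),
    ← integral_sub h3 (h4.const_mul _), ← integral_const_mul, ← integral_const_mul,
    ← integral_sub ((h1.fun_add (h2.const_mul _)).const_mul _) (h34.const_mul _)]
  refine integral_congr_ae (.of_forall fun t => ?_)
  simp only [circleMap_mul_exp_neg]
  have hne : 1 - circleMap 0 r (x - t) ≠ 0 :=
    one_sub_ne_zero_of_norm_lt_one (norm_circleMap_lt_one hr0 hr1 _)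
  have hgeom : ∑ k ∈ range (2 * n + 1), circleMap 0 r (x - t) ^ k =
      (1 - circleMap 0 r (x - t) ^ (2 * n + 1)) * (1 - circleMap 0 r (x - t))⁻¹ := by
    rw [← mul_neg_geom_sum, mul_comm (1 - _), mul_assoc, mul_inv_cancel₀ hne, mul_one]
  have e1 : (cos (n * t) : ℂ) + Complex.I * (sin (n * t) : ℂ) =
      Complex.exp ((n * t : ℝ) * Complex.I) := by
    rw [Complex.exp_mul_I]; push_cast; ring
  have e2 : (cos ((n + 1) * t) : ℂ) - Complex.I * (sin ((n + 1) * t) : ℂ) =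
      Complex.exp (-((n + 1) * t : ℝ) * Complex.I) := by
    rw [Complex.exp_mul_I, Complex.cos_neg, Complex.sin_neg]; push_cast; ring
  have e3 : Complex.exp (-(n * (x - t : ℝ) * Complex.I)) =
      Complex.exp (-(n * x : ℝ) * Complex.I) * Complex.exp ((n * t : ℝ) * Complex.I) := by
    rw [← Complex.exp_add]; push_cast; ring_nf
  have e4 : Complex.exp (-(n * (x - t : ℝ) * Complex.I)) * circleMap 0 r (x - t) ^ (2 * n + 1) =
      (r : ℂ) ^ (2 * n + 1) * Complex.exp (((n + 1) * x : ℝ) * Complex.I) *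
        Complex.exp (-((n + 1) * t : ℝ) * Complex.I) := by
    rw [circleMap, zero_add, mul_pow, ← Complex.exp_nat_mul, mul_left_comm, ← Complex.exp_add,
      mul_assoc ((r : ℂ) ^ _), ← Complex.exp_add]
    push_cast; ring_nf
  rw [hgeom, ← mul_assoc (Complex.exp _), mul_sub, mul_one, e4, e3, ← e1, ← e2]
  push_cast
  ring

lemma abelPartialSum_eq_sum {f : ℝ → ℝ} (hf : Integrable f periodMeasure) (n : ℕ) (r x : ℝ) :
    abelPartialSum f n r x = ∑ k ∈ range (2 * n + 1), (r : ℂ) ^ k *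
      ∫ t, (f t : ℂ) * (Complex.exp (-(n * (x - t : ℝ) * Complex.I)) *
        circleMap 0 1 (x - t) ^ k) ∂periodMeasure := by
  simp_rw [← integral_const_mul]
  have hw : ∀ u, circleMap 0 r u = r * circleMap 0 1 u := fun u => by simp [circleMap]
  rw [← integral_finsetSum]
  · refine integral_congr_ae (.of_forall fun t => ?_)
    simp only [mul_sum]
    refine sum_congr rfl fun k _ => ?_
    rw [hw, mul_pow]; ring
  · intro k _
    refine Integrable.const_mul ?_ _
    refine hf.ofReal.mul_bdd (c := 1) (Continuous.aestronglyMeasurable (by fun_prop))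
      (.of_forall fun t => ?_)
    rw [norm_mul, norm_pow, norm_circleMap_zero, abs_one, one_pow, mul_one]
    have : -(n * (x - t : ℝ) * Complex.I) = ((-(n * (x - t)) : ℝ) : ℂ) * Complex.I := by
      push_cast; ring
    rw [this, Complex.norm_exp_ofReal_mul_I]

lemma abelPartialSum_one {f : ℝ → ℝ} (n : ℕ) (x : ℝ) :
    abelPartialSum f n 1 x = ((2 * π * partialFourierSum f n x : ℝ) : ℂ) := by
  simp only [abelPartialSum, exp_mul_sum_exp_eq_dirichletKernel]
  rw [partialFourierSum_eq, show 2 * π * (1 / π * ∫ t, f t * dirichletKernel n (x - t)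
    ∂periodMeasure) = 2 * ∫ t, f t * dirichletKernel n (x - t) ∂periodMeasure by
      field_simp, ← integral_const_mul, ← integral_complex_ofReal]
  refine integral_congr_ae (.of_forall fun t => ?_)
  push_cast
  ring

lemma exists_eLpNorm_abelPartialSum_le {p : ℝ} (hp : 1 < p) (hp2 : p ≤ 2) :
    ∃ C : NNReal, ∀ f : ℝ → ℝ, Function.Periodic f (2 * π) → AEStronglyMeasurable f volume →
      Integrable f periodMeasure → ∀ (n : ℕ) (r : ℝ), 0 ≤ r → r < 1 →
      eLpNorm (abelPartialSum f n r) (ENNReal.ofReal p) periodMeasure ≤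
        C * eLpNorm f (ENNReal.ofReal p) periodMeasure := by
  obtain ⟨C, hC⟩ := exists_eLpNorm_cauchyTransform_le hp hp2
  have hp1 : 1 ≤ ENNReal.ofReal p := by simpa using hp.le
  refine ⟨4 * C, fun f hper hf hfi n r hr0 hr1 => ?_⟩
  have hcosP : ∀ k : ℕ, Function.Periodic (fun t : ℝ => cos (k * t)) (2 * π) := fun k t => by
    simp only [mul_add]; exact cos_add_nat_mul_two_pi _ k
  have hsinP : ∀ k : ℕ, Function.Periodic (fun t : ℝ => sin (k * t)) (2 * π) := fun k t => by
    simp only [mul_add]; exact sin_add_nat_mul_two_pi _ k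
  have hbound : ∀ c : ℝ → ℝ, Continuous c → Function.Periodic c (2 * π) → (∀ t, |c t| ≤ 1) →
      eLpNorm (fun x => ‖cauchyTransform (fun t => f t * c t) (circleMap 0 r x)‖)
        (ENNReal.ofReal p) periodMeasure ≤ C * eLpNorm f (ENNReal.ofReal p) periodMeasure := by
    intro c hc hcper hc1
    rw [eLpNorm_norm]
    refine (hC _ (hper.mul hcper) (hf.mul hc.aestronglyMeasurable)
      (hfi.mul_continuous_periodMeasure hc) r hr0 hr1).trans
        (mul_le_mul_right (eLpNorm_mono fun t => ?_) _)
    simp only [Pi.mul_apply, norm_mul]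
    exact mul_le_of_le_one_right (norm_nonneg _) (hc1 t)
  have hmeas : ∀ c : ℝ → ℝ, Continuous c → AEStronglyMeasurable
      (fun x => ‖cauchyTransform (fun t => f t * c t) (circleMap 0 r x)‖) periodMeasure :=
    fun c hc => (continuous_cauchyTransform_circleMap (hfi.mul_continuous_periodMeasure hc)
      hr0 hr1).norm.aestronglyMeasurable
  have m1 := hmeas (fun t => cos (n * t)) (by fun_prop)
  have m2 := hmeas (fun t => sin (n * t)) (by fun_prop)
  have m3 := hmeas (fun t => cos ((n + 1) * t)) (by fun_prop)
  have m4 := hmeas (fun t => sin ((n + 1) * t)) (by fun_prop)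
  have b1 := hbound (fun t => cos (n * t)) (by fun_prop) (hcosP n) fun t => abs_cos_le_one _
  have b2 := hbound (fun t => sin (n * t)) (by fun_prop) (hsinP n) fun t => abs_sin_le_one _
  have b3 := hbound (fun t => cos ((n + 1) * t)) (by fun_prop)
    (by exact_mod_cast hcosP (n + 1)) fun t => abs_cos_le_one _
  have b4 := hbound (fun t => sin ((n + 1) * t)) (by fun_prop)
    (by exact_mod_cast hsinP (n + 1)) fun t => abs_sin_le_one _
  refine le_trans (eLpNorm_mono_real (g :=
    ((fun x => ‖cauchyTransform (fun t => f t * cos (n * t)) (circleMap 0 r x)‖) +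
      fun x => ‖cauchyTransform (fun t => f t * sin (n * t)) (circleMap 0 r x)‖) +
    ((fun x => ‖cauchyTransform (fun t => f t * cos ((n + 1) * t)) (circleMap 0 r x)‖) +
      fun x => ‖cauchyTransform (fun t => f t * sin ((n + 1) * t)) (circleMap 0 r x)‖))
    fun x => ?_) ?_
  · rw [abelPartialSum_eq_cauchyTransform hfi n hr0 hr1]
    simp only [Pi.add_apply]
    refine (norm_sub_le _ _).trans (add_le_add ?_ ?_)
    · rw [norm_mul, ← Complex.ofReal_neg, Complex.norm_exp_ofReal_mul_I, one_mul]
      refine (norm_add_le _ _).trans_eq ?_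
      rw [norm_mul, Complex.norm_I, one_mul]
    · rw [norm_mul, norm_mul, Complex.norm_exp_ofReal_mul_I, mul_one, norm_pow, Complex.norm_real,
        Real.norm_of_nonneg hr0]
      refine (mul_le_of_le_one_left (norm_nonneg _) (pow_le_one₀ hr0 hr1.le)).trans ?_
      refine (norm_sub_le _ _).trans_eq ?_
      rw [norm_mul, Complex.norm_I, one_mul]
  · refine (eLpNorm_add_le (m1.add m2) (m3.add m4) hp1).trans ?_
    refine (add_le_add (eLpNorm_add_le m1 m2 hp1) (eLpNorm_add_le m3 m4 hp1)).trans ?_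
    refine (add_le_add (add_le_add b1 b2) (add_le_add b3 b4)).trans_eq ?_
    rw [ENNReal.coe_mul, ENNReal.coe_ofNat]
    ring

/-- M. Riesz's theorem for `1 < p ≤ 2`: Fourier partial sums are uniformly bounded on `L^p`. -/
lemma exists_eLpNorm_partialFourierSum_le_of_le_two {p : ℝ} (hp : 1 < p) (hp2 : p ≤ 2) :
    ∃ C : NNReal, ∀ f : ℝ → ℝ, Function.Periodic f (2 * π) → AEStronglyMeasurable f volume →
      Integrable f periodMeasure → ∀ n : ℕ,
      eLpNorm (partialFourierSum f n) (ENNReal.ofReal p) periodMeasure ≤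
        C * eLpNorm f (ENNReal.ofReal p) periodMeasure := by
  obtain ⟨C, hC⟩ := exists_eLpNorm_abelPartialSum_le hp hp2
  refine ⟨C, fun f hper hf hfi n => ?_⟩
  set r : ℕ → ℝ := fun j => 1 - 1 / ((j : ℝ) + 1) with hr
  have hj : ∀ j : ℕ, 0 < 1 / ((j : ℝ) + 1) ∧ 1 / ((j : ℝ) + 1) ≤ 1 := fun j =>
    ⟨by positivity, by
      rw [div_le_one (by positivity)]; linarith [(Nat.cast_nonneg j : (0 : ℝ) ≤ j)]⟩
  have hr0 : ∀ j, 0 ≤ r j := fun j => by linarith [hj j, (hj j).2]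
  have hr1 : ∀ j, r j < 1 := fun j => by linarith [(hj j).1]
  have hlim : Filter.Tendsto r Filter.atTop (nhds 1) := by
    simpa [hr] using (tendsto_one_div_add_atTop_nhds_zero_nat (𝕜 := ℝ)).const_sub (1 : ℝ)
  have hmeas : ∀ j, AEStronglyMeasurable (abelPartialSum f n (r j)) periodMeasure := fun j => by
    have hc : ∀ c : ℝ → ℝ, Continuous c → Continuous
        fun x => cauchyTransform (fun t => f t * c t) (circleMap 0 (r j) x) := fun c hc =>
      continuous_cauchyTransform_circleMap (hfi.mul_continuous_periodMeasure hc) (hr0 j) (hr1 j)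
    have h1 := hc (fun t => cos (n * t)) (by fun_prop)
    have h2 := hc (fun t => sin (n * t)) (by fun_prop)
    have h3 := hc (fun t => cos ((n + 1) * t)) (by fun_prop)
    have h4 := hc (fun t => sin ((n + 1) * t)) (by fun_prop)
    rw [funext (abelPartialSum_eq_cauchyTransform hfi n (hr0 j) (hr1 j))]
    exact Continuous.aestronglyMeasurable (by fun_prop)
  have hfatou := Lp.eLpNorm_lim_le_liminf_eLpNorm (p := ENNReal.ofReal p) hmeas
    (abelPartialSum f n 1) (.of_forall fun x => by
      simp_rw [abelPartialSum_eq_sum hfi]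
      refine tendsto_finsetSum _ fun k _ => Filter.Tendsto.mul_const _ ?_
      refine Filter.Tendsto.pow ?_ k
      exact (Complex.continuous_ofReal.tendsto 1).comp hlim)
  calc eLpNorm (partialFourierSum f n) (ENNReal.ofReal p) periodMeasure
      ≤ eLpNorm (abelPartialSum f n 1) (ENNReal.ofReal p) periodMeasure := by
        refine eLpNorm_mono fun x => ?_
        rw [abelPartialSum_one, Complex.norm_real, norm_mul]
        refine le_mul_of_one_le_left (norm_nonneg _) ?_
        rw [Real.norm_of_nonneg two_pi_pos.le]
        linarith [pi_gt_three]
    _ ≤ _ := hfatou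
    _ ≤ C * eLpNorm f (ENNReal.ofReal p) periodMeasure := by
        refine (Filter.liminf_le_liminf (.of_forall fun j =>
          hC f hper hf hfi n (r j) (hr0 j) (hr1 j))).trans ?_
        simp

lemma integral_partialFourierSum_mul {f g : ℝ → ℝ} (hf : Integrable f periodMeasure)
    (hg : Integrable g periodMeasure) (n : ℕ) :
    ∫ x, partialFourierSum f n x * g x ∂periodMeasure =
      1 / π * ((∫ t, f t ∂periodMeasure) * (∫ t, g t ∂periodMeasure) * (1 / 2) +
        ∑ k ∈ Icc 1 n, ((∫ t, f t * cos (k * t) ∂periodMeasure) *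
            (∫ t, g t * cos (k * t) ∂periodMeasure) +
          (∫ t, f t * sin (k * t) ∂periodMeasure) *
            ∫ t, g t * sin (k * t) ∂periodMeasure)) := by
  have hc : ∀ k : ℕ, Integrable (fun t => g t * cos (k * t)) periodMeasure := fun k =>
    hg.mul_continuous_periodMeasure (by fun_prop)
  have hs : ∀ k : ℕ, Integrable (fun t => g t * sin (k * t)) periodMeasure := fun k =>
    hg.mul_continuous_periodMeasure (by fun_prop)
  have hsum : Integrable (fun x => ∑ k ∈ Icc 1 n,
      ((∫ t, f t * cos (k * t) ∂periodMeasure) * (g x * cos (k * x)) +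
        (∫ t, f t * sin (k * t) ∂periodMeasure) * (g x * sin (k * x)))) periodMeasure :=
    integrable_finsetSum _ fun k _ => ((hc k).const_mul _).fun_add ((hs k).const_mul _)
  calc ∫ x, partialFourierSum f n x * g x ∂periodMeasure
      = ∫ x, 1 / π * ((∫ t, f t ∂periodMeasure) * (1 / 2) * g x + ∑ k ∈ Icc 1 n,
          ((∫ t, f t * cos (k * t) ∂periodMeasure) * (g x * cos (k * x)) +
            (∫ t, f t * sin (k * t) ∂periodMeasure) * (g x * sin (k * x)))) ∂periodMeasure := by
        refine integral_congr_ae (.of_forall fun x => ?_)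
        simp only [partialFourierSum_eq_trig hf, mul_assoc, add_mul, Finset.sum_mul]
        congr 2
        exact Finset.sum_congr rfl fun k _ => by ring
    _ = _ := by
        rw [integral_const_mul, integral_add (hg.const_mul _) hsum, integral_const_mul,
          integral_finsetSum _ fun k _ => ((hc k).const_mul _).fun_add ((hs k).const_mul _)]
        congr 2
        · ring
        · refine Finset.sum_congr rfl fun k _ => ?_
          rw [integral_add ((hc k).const_mul _) ((hs k).const_mul _), integral_const_mul,
            integral_const_mul]

/-- Fourier partial sum operators are symmetric. -/
lemma integral_partialFourierSum_mul_comm {f g : ℝ → ℝ} (hf : Integrable f periodMeasure)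
    (hg : Integrable g periodMeasure) (n : ℕ) :
    ∫ x, partialFourierSum f n x * g x ∂periodMeasure =
      ∫ x, f x * partialFourierSum g n x ∂periodMeasure := by
  simp_rw [mul_comm (f _) _]
  rw [integral_partialFourierSum_mul hf hg, integral_partialFourierSum_mul hg hf]
  congr 2
  · ring
  · exact Finset.sum_congr rfl fun k _ => by ring

lemma periodic_dirichletKernel (n : ℕ) : Function.Periodic (dirichletKernel n) (2 * π) := by
  intro x
  unfold dirichletKernel
  congr 1
  refine Finset.sum_congr rfl fun k _ => ?_
  rw [mul_add, cos_add_nat_mul_two_pi]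

lemma periodic_partialFourierSum (f : ℝ → ℝ) (n : ℕ) :
    Function.Periodic (partialFourierSum f n) (2 * π) := by
  intro x
  unfold partialFourierSum
  simp_rw [add_sub_right_comm, periodic_dirichletKernel n _]

/-- M. Riesz's theorem: for `1 < p < ∞`, Fourier partial sums are uniformly bounded on `L^p`. -/
lemma exists_eLpNorm_partialFourierSum_le {p : ℝ} (hp : 1 < p) :
    ∃ C : NNReal, ∀ f : ℝ → ℝ, Function.Periodic f (2 * π) → AEStronglyMeasurable f volume →
      Integrable f periodMeasure → ∀ n : ℕ,
      eLpNorm (partialFourierSum f n) (ENNReal.ofReal p) periodMeasure ≤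
        C * eLpNorm f (ENNReal.ofReal p) periodMeasure := by
  rcases le_or_gt p 2 with hp2 | hp2
  · exact exists_eLpNorm_partialFourierSum_le_of_le_two hp hp2
  have hp0 : 0 < p := by linarith
  have hpq : p.HolderConjugate (p.conjExponent) := Real.HolderConjugate.conjExponent hp
  set q := p.conjExponent with hq
  have hq2 : q ≤ 2 := by
    rw [hq, Real.conjExponent, div_le_iff₀ (by linarith)]; linarith
  have hmul : (p - 1) * q = p := by
    rw [hq, Real.conjExponent]; field_simp [show p - 1 ≠ 0 by linarith]
  obtain ⟨C, hC⟩ := exists_eLpNorm_partialFourierSum_le_of_le_two hpq.symm.lt hq2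
  refine ⟨C, fun f hper hf hfi n => ?_⟩
  set s := partialFourierSum f n with hs
  have hsc : Continuous s := continuous_partialFourierSum hfi n
  set h : ℝ → ℝ := fun x => |s x| ^ (p - 2) * s x with hh
  have hhc : Continuous h :=
    (hsc.abs.rpow_const fun x => Or.inr (by linarith)).mul hsc
  have hhi := integrable_periodMeasure_of_continuous hhc
  have hhper : Function.Periodic h (2 * π) := fun x => by
    simp only [hh, hs, periodic_partialFourierSum f n x]
  have hnorm : ∀ x, ‖h x‖ₑ = ‖s x‖ₑ ^ (p - 1) := fun x => by
    rw [← ofReal_norm, ← ofReal_norm, ENNReal.ofReal_rpow_of_nonneg (norm_nonneg _) (by linarith),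
      hh, norm_mul, norm_of_nonneg (by positivity), norm_eq_abs, ← rpow_add_one' (abs_nonneg _)
        (by linarith)]
    congr 2; ring
  have hsh : ∀ x, ‖s x‖ₑ ^ p = ENNReal.ofReal (s x * h x) := fun x => by
    rw [← ofReal_norm, ENNReal.ofReal_rpow_of_nonneg (norm_nonneg _) hp0.le, norm_eq_abs]
    congr 1
    rw [show s x * h x = |s x| ^ (p - 2) * (s x * s x) by simp only [hh]; ring, ← abs_mul_abs_self,
      ← mul_assoc, ← rpow_add_one' (abs_nonneg _) (by linarith),
      ← rpow_add_one' (abs_nonneg _) (by linarith)]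
    congr 1; ring
  have hshi : Integrable (fun x => s x * h x) periodMeasure :=
    integrable_periodMeasure_of_continuous (hsc.mul hhc)
  have hsh0 : ∀ x, 0 ≤ s x * h x := fun x => by
    rw [show s x * h x = |s x| ^ (p - 2) * (s x * s x) by simp only [hh]; ring]
    exact mul_nonneg (by positivity) (mul_self_nonneg _)
  have hnp : ∀ (g : ℝ → ℝ) {r : ℝ}, 0 < r → eLpNorm g (ENNReal.ofReal r) periodMeasure =
      (∫⁻ x, ‖g x‖ₑ ^ r ∂periodMeasure) ^ (1 / r) := fun g r hr => by
    rw [eLpNorm_eq_lintegral_rpow_enorm_toReal (by simpa using hr) ENNReal.ofReal_ne_top,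
      ENNReal.toReal_ofReal hr.le]
  set I := ∫⁻ x, ‖s x‖ₑ ^ p ∂periodMeasure with hI
  have hIint : I = ENNReal.ofReal (∫ x, s x * h x ∂periodMeasure) := by
    rw [ofReal_integral_eq_lintegral_ofReal hshi (.of_forall hsh0)]
    exact lintegral_congr hsh
  have hhq : eLpNorm h (ENNReal.ofReal q) periodMeasure = I ^ (1 / q) := by
    rw [hnp h hpq.symm.pos]
    congr 1
    refine lintegral_congr fun x => ?_
    rw [hnorm, ← ENNReal.rpow_mul, hmul]
  have hholder : I ≤ eLpNorm f (ENNReal.ofReal p) periodMeasure *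
      (C * I ^ (1 / q)) := by
    calc I ≤ ‖∫ x, s x * h x ∂periodMeasure‖ₑ := by
          rw [hIint, ← ofReal_norm]; exact ENNReal.ofReal_le_ofReal (le_norm_self _)
      _ = ‖∫ x, f x * partialFourierSum h n x ∂periodMeasure‖ₑ := by
          rw [hs, integral_partialFourierSum_mul_comm hfi hhi]
      _ ≤ ∫⁻ x, ‖f x‖ₑ * ‖partialFourierSum h n x‖ₑ ∂periodMeasure := by
          refine (enorm_integral_le_lintegral_enorm _).trans_eq ?_
          simp_rw [enorm_mul]
      _ ≤ eLpNorm f (ENNReal.ofReal p) periodMeasure *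
            eLpNorm (partialFourierSum h n) (ENNReal.ofReal q) periodMeasure := by
          rw [hnp f hp0, hnp _ hpq.symm.pos]
          exact ENNReal.lintegral_mul_le_Lp_mul_Lq _ hpq hfi.aestronglyMeasurable.enorm
            (continuous_partialFourierSum hhi n).aestronglyMeasurable.enorm
      _ ≤ _ := by
          refine mul_le_mul_right ?_ _
          rw [← hhq]
          exact hC h hhper hhc.aestronglyMeasurable hhi n
  rw [hnp s hp0, ← hI]
  have hItop : I ≠ ⊤ := by rw [hIint]; exact ENNReal.ofReal_ne_top
  rcases eq_or_ne I 0 with h0 | h0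
  · rw [h0, ENNReal.zero_rpow_of_pos (by positivity)]; exact zero_le
  · have hsplit : I ^ (1 / p) * I ^ (1 / q) = I := by
      rw [← ENNReal.rpow_add _ _ h0 hItop, one_div, one_div, hpq.inv_add_inv_eq_one,
        ENNReal.rpow_one]
    have hq0 : I ^ (1 / q) ≠ 0 := by simp [h0, hItop]
    have hqt : I ^ (1 / q) ≠ ⊤ := by
      exact ENNReal.rpow_ne_top_of_nonneg (by have := hpq.symm.pos; positivity) hItop
    refine (ENNReal.mul_le_mul_iff_left hq0 hqt).1 ?_
    rw [hsplit]
    calc I ≤ _ := hholder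
      _ = _ := by ring

lemma integral_cos_int_mul_add {j : ℤ} (hj : j ≠ 0) (θ : ℝ) :
    ∫ t, cos (j * t + θ) ∂periodMeasure = 0 := by
  have hj' : (j : ℝ) ≠ 0 := by exact_mod_cast hj
  rw [integral_periodMeasure_eq, intervalIntegral.integral_comp_mul_add (fun t => cos t) hj',
    integral_cos, show (j : ℝ) * (2 * π) + θ = θ + j * (2 * π) by ring,
    sin_add_int_mul_two_pi]
  simp

lemma integral_cos_mul_cos_sub {m k : ℕ} (hk : 1 ≤ k) (θ x : ℝ) :
    ∫ t, cos (m * t + θ) * cos (k * (x - t)) ∂periodMeasure =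
      if k = m then π * cos (m * x + θ) else 0 := by
  have hprod : ∀ t, cos (m * t + θ) * cos (k * (x - t)) =
      1 / 2 * cos (((m - k : ℤ) : ℝ) * t + (k * x + θ)) +
        1 / 2 * cos (((m + k : ℤ) : ℝ) * t + (θ - k * x)) := fun t => by
    have h1 := cos_add (m * t + θ) (k * (x - t))
    have h2 := cos_sub (m * t + θ) (k * (x - t))
    rw [show ((m - k : ℤ) : ℝ) * t + (k * x + θ) = m * t + θ + k * (x - t) by push_cast; ring,
      show ((m + k : ℤ) : ℝ) * t + (θ - k * x) = m * t + θ - k * (x - t) by push_cast; ring,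
      h1, h2]
    ring
  have hi : ∀ c d : ℝ, Integrable (fun t => 1 / 2 * cos (c * t + d)) periodMeasure := fun c d =>
    integrable_periodMeasure_of_continuous (by fun_prop)
  simp_rw [hprod]
  rw [integral_add (hi _ _) (hi _ _), integral_const_mul, integral_const_mul,
    integral_cos_int_mul_add (j := m + k) (by omega)]
  split_ifs with h
  · subst h
    simp only [sub_self, Int.cast_zero, zero_mul, zero_add, mul_zero, add_zero,
      integral_periodMeasure_eq, intervalIntegral.integral_const, sub_zero, smul_eq_mul]
    ring
  · rw [integral_cos_int_mul_add (j := m - k) (by omega)]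
    simp

lemma partialFourierSum_cos {m n : ℕ} (hmn : m ≤ n) (θ x : ℝ) :
    partialFourierSum (fun t => cos (m * t + θ)) n x = cos (m * x + θ) := by
  have hi : ∀ k : ℕ, Integrable (fun t => cos (m * t + θ) * cos (k * (x - t))) periodMeasure :=
    fun k => integrable_periodMeasure_of_continuous (by fun_prop)
  rw [partialFourierSum_eq]
  simp_rw [dirichletKernel, mul_add, Finset.mul_sum]
  rw [integral_add (integrable_periodMeasure_of_continuous (by fun_prop))
    (integrable_finsetSum _ fun k _ => hi k), integral_finsetSum _ fun k _ => hi k,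
    integral_mul_const, Finset.sum_congr rfl fun k hk =>
      integral_cos_mul_cos_sub (m := m) (Finset.mem_Icc.1 hk).1 θ x]
  rw [Finset.sum_ite_eq' (Icc 1 n) m]
  rcases Nat.eq_zero_or_pos m with rfl | hm
  · simp only [CharP.cast_eq_zero, zero_mul, zero_add, integral_const,
      measureReal_restrict_apply_univ, volume_real_Ioc_of_le two_pi_pos.le, sub_zero, smul_eq_mul, mem_Icc, nonpos_iff_eq_zero,
      one_ne_zero, false_and, if_false, add_zero]
    field_simp
  · have h0 := integral_cos_int_mul_add (j := m) (by omega) θ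
    push_cast at h0
    rw [h0, if_pos (Finset.mem_Icc.2 ⟨hm, hmn⟩)]
    field_simp
    ring

lemma partialFourierSum_add {f g : ℝ → ℝ} (hf : Integrable f periodMeasure)
    (hg : Integrable g periodMeasure) (n : ℕ) (x : ℝ) :
    partialFourierSum (f + g) n x = partialFourierSum f n x + partialFourierSum g n x := by
  have hD : Continuous fun t => dirichletKernel n (x - t) :=
    (continuous_dirichletKernel n).comp (by fun_prop)
  simp only [partialFourierSum_eq, Pi.add_apply, add_mul]
  rw [integral_add (hf.mul_continuous_periodMeasure hD) (hg.mul_continuous_periodMeasure hD),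
    mul_add]

lemma partialFourierSum_smul (c : ℝ) (f : ℝ → ℝ) (n : ℕ) (x : ℝ) :
    partialFourierSum (c • f) n x = c * partialFourierSum f n x := by
  simp only [partialFourierSum_eq, Pi.smul_apply, smul_eq_mul, mul_assoc, integral_const_mul]
  ring

/-- The continuous functions that coincide with their `n`-th Fourier partial sum. -/
def partialFourierSumFixed (n : ℕ) : Submodule ℝ (ℝ → ℝ) where
  carrier := {g | Continuous g ∧ ∀ x, partialFourierSum g n x = g x}
  add_mem' := fun {f g} hf hg => ⟨hf.1.add hg.1, fun x => by
    rw [partialFourierSum_add (integrable_periodMeasure_of_continuous hf.1)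
      (integrable_periodMeasure_of_continuous hg.1), hf.2, hg.2, Pi.add_apply]⟩
  zero_mem' := ⟨continuous_zero, fun x => by simp [partialFourierSum_eq]⟩
  smul_mem' := fun c f hf => ⟨hf.1.const_smul c, fun x => by
    rw [partialFourierSum_smul, hf.2, Pi.smul_apply, smul_eq_mul]⟩

lemma cos_mem_partialFourierSumFixed {m n : ℕ} (hmn : m ≤ n) (θ : ℝ) :
    (fun t => cos (m * t + θ)) ∈ partialFourierSumFixed n :=
  ⟨by fun_prop, partialFourierSum_cos hmn θ⟩

lemma partialFourierSum_mem_partialFourierSumFixed {f : ℝ → ℝ} (hf : Integrable f periodMeasure)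
    {k n : ℕ} (hkn : k ≤ n) : partialFourierSum f k ∈ partialFourierSumFixed n := by
  have hrep : partialFourierSum f k = (1 / π) • (((∫ t, f t ∂periodMeasure) * (1 / 2)) •
      (fun t => cos ((0 : ℕ) * t + 0)) + ∑ j ∈ Icc 1 k,
        ((∫ t, f t * cos (j * t) ∂periodMeasure) • (fun t => cos (j * t + 0)) +
          (∫ t, f t * sin (j * t) ∂periodMeasure) • fun t => cos (j * t + (-(π / 2))))) := by
    ext x
    rw [partialFourierSum_eq_trig hf]
    simp [← sub_eq_add_neg, cos_sub_pi_div_two]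
  rw [hrep]
  refine Submodule.smul_mem _ _ (Submodule.add_mem _ (Submodule.smul_mem _ _
    (cos_mem_partialFourierSumFixed (Nat.zero_le n) 0)) (Submodule.sum_mem _ fun j hj => ?_))
  have hjn : j ≤ n := (Finset.mem_Icc.1 hj).2.trans hkn
  exact Submodule.add_mem _ (Submodule.smul_mem _ _ (cos_mem_partialFourierSumFixed hjn _))
    (Submodule.smul_mem _ _ (cos_mem_partialFourierSumFixed hjn _))

/-- The Fejér means `σ_n(f;x) = (1/(n+1)) ∑_{k=0}^n S_k(f;x)`. -/
noncomputable def fejerMean (f : ℝ → ℝ) (n : ℕ) : ℝ → ℝ :=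
  (1 / ((n : ℝ) + 1)) • ∑ k ∈ range (n + 1), partialFourierSum f k

lemma fejerMean_mem_partialFourierSumFixed {f : ℝ → ℝ} (hf : Integrable f periodMeasure)
    (n : ℕ) : fejerMean f n ∈ partialFourierSumFixed n :=
  Submodule.smul_mem _ _ (Submodule.sum_mem _ fun _ hk =>
    partialFourierSum_mem_partialFourierSumFixed hf (Nat.lt_succ_iff.1 (Finset.mem_range.1 hk)))

lemma periodic_fejerMean (f : ℝ → ℝ) (n : ℕ) : Function.Periodic (fejerMean f n) (2 * π) := by
  intro x
  simp only [fejerMean, Pi.smul_apply, Finset.sum_apply, periodic_partialFourierSum f _ x]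

/-- In `L^p`, `1 < p < ∞`, Fourier partial sums approximate as well as Fejér means. -/
lemma exists_eLpNorm_partialFourierSum_sub_le {p : ℝ} (hp : 1 < p) :
    ∃ C : NNReal, ∀ f : ℝ → ℝ, Function.Periodic f (2 * π) → AEStronglyMeasurable f volume →
      Integrable f periodMeasure → ∀ n : ℕ,
      eLpNorm (partialFourierSum f n - f) (ENNReal.ofReal p) periodMeasure ≤
        C * eLpNorm (fejerMean f n - f) (ENNReal.ofReal p) periodMeasure := by
  obtain ⟨C, hC⟩ := exists_eLpNorm_partialFourierSum_le hp
  refine ⟨C + 1, fun f hper hf hfi n => ?_⟩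
  obtain ⟨hσc, hσ⟩ := fejerMean_mem_partialFourierSumFixed hfi n
  set d := fejerMean f n - f with hd
  have hσi := integrable_periodMeasure_of_continuous hσc
  have hdi : Integrable d periodMeasure := hσi.sub hfi
  have hdper : Function.Periodic d (2 * π) := (periodic_fejerMean f n).sub hper
  have hdm : AEStronglyMeasurable d volume := hσc.aestronglyMeasurable.sub hf
  have hrep : partialFourierSum f n - f = d - partialFourierSum d n := by
    ext x
    have h1 := partialFourierSum_add hfi hdi n x
    rw [show f + d = fejerMean f n by rw [hd]; abel, hσ] at h1
    simp only [Pi.sub_apply, hd] at h1 ⊢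
    linarith
  rw [hrep]
  refine (eLpNorm_sub_le hdi.aestronglyMeasurable
    (continuous_partialFourierSum hdi n).aestronglyMeasurable (by simpa using hp.le)).trans ?_
  refine (add_le_add_right (hC d hdper hdm hdi n) _).trans_eq ?_
  push_cast
  ring

lemma dirichletKernel_succ (n : ℕ) (u : ℝ) :
    dirichletKernel (n + 1) u = dirichletKernel n u + cos ((n + 1) * u) := by
  unfold dirichletKernel
  rw [Finset.sum_Icc_succ_top (by omega)]
  push_cast
  ring

lemma two_mul_one_sub_cos_mul_dirichletKernel (n : ℕ) (u : ℝ) :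
    2 * (1 - cos u) * dirichletKernel n u = cos (n * u) - cos ((n + 1) * u) := by
  induction n with
  | zero => simp [dirichletKernel]; ring
  | succ n ih =>
    rw [dirichletKernel_succ, mul_add, ih]
    push_cast
    rw [show (n : ℝ) * u = (n + 1) * u - u by ring,
      show ((n : ℝ) + 1 + 1) * u = (n + 1) * u + u by ring, cos_sub, cos_add]
    ring

lemma two_mul_one_sub_cos_mul_sum_dirichletKernel (n : ℕ) (u : ℝ) :
    2 * (1 - cos u) * ∑ k ∈ range n, dirichletKernel k u = 1 - cos (n * u) := by
  induction n with
  | zero => simp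
  | succ n ih =>
    rw [Finset.sum_range_succ, mul_add, ih, two_mul_one_sub_cos_mul_dirichletKernel]
    push_cast
    ring

lemma abs_dirichletKernel_le (n : ℕ) (u : ℝ) : |dirichletKernel n u| ≤ n + 1 / 2 := by
  induction n with
  | zero => simp [dirichletKernel]
  | succ n ih =>
    rw [dirichletKernel_succ]
    push_cast
    linarith [abs_add_le (dirichletKernel n u) (cos ((n + 1) * u)), abs_cos_le_one ((n + 1) * u)]

lemma abs_sum_dirichletKernel_le (n : ℕ) (u : ℝ) :
    |∑ k ∈ range n, dirichletKernel k u| ≤ n ^ 2 / 2 := by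
  induction n with
  | zero => simp
  | succ n ih =>
    rw [Finset.sum_range_succ]
    refine (abs_add_le _ _).trans ((add_le_add ih (abs_dirichletKernel_le n u)).trans_eq ?_)
    push_cast
    ring

/-- The Fejér kernel, normalized to have integral `1` over a period. -/
noncomputable def fejerKernel (n : ℕ) (u : ℝ) : ℝ :=
  1 / (π * (n + 1)) * ∑ k ∈ range (n + 1), dirichletKernel k u

lemma continuous_fejerKernel (n : ℕ) : Continuous (fejerKernel n) :=
  continuous_const.mul (continuous_finsetSum _ fun k _ => continuous_dirichletKernel k)

lemma periodic_fejerKernel (n : ℕ) : Function.Periodic (fejerKernel n) (2 * π) := by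
  intro x
  simp only [fejerKernel, periodic_dirichletKernel _ x]

lemma abs_fejerKernel_le (n : ℕ) {u : ℝ} (hu : |u| ≤ π) :
    |fejerKernel n u| ≤ 2 * (n + 1) / (1 + ((n + 1) * u) ^ 2) := by
  set S := ∑ k ∈ range (n + 1), dirichletKernel k u with hS
  have hN : (0 : ℝ) < n + 1 := by positivity
  have h1 : |S| ≤ (n + 1) ^ 2 / 2 := by
    have := abs_sum_dirichletKernel_le (n + 1) u
    push_cast at this
    exact this
  have h2 : |S| * u ^ 2 ≤ π ^ 2 / 2 := by
    have hid := congrArg abs (two_mul_one_sub_cos_mul_sum_dirichletKernel (n + 1) u)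
    rw [abs_mul, abs_of_nonneg (by linarith [cos_le_one u]), ← hS] at hid
    have hle : |1 - cos (((n + 1 : ℕ) : ℝ) * u)| ≤ 2 := by
      rw [abs_le]
      constructor <;> linarith [cos_le_one (((n + 1 : ℕ) : ℝ) * u),
        neg_one_le_cos (((n + 1 : ℕ) : ℝ) * u)]
    have hcos := cos_le_one_sub_mul_cos_sq hu
    have : 2 * (2 / π ^ 2 * u ^ 2) * |S| ≤ 2 := by
      refine le_trans ?_ (hid.trans_le hle)
      gcongr
      linarith
    have hpi : 0 < π ^ 2 := by positivity
    rw [show 2 * (2 / π ^ 2 * u ^ 2) * |S| = 4 * (|S| * u ^ 2) / π ^ 2 by ring,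
      div_le_iff₀ hpi] at this
    linarith
  have hF : |fejerKernel n u| = |S| / (π * (n + 1)) := by
    rw [fejerKernel, abs_mul, abs_of_pos (by positivity), ← hS]; ring
  rw [hF, div_le_div_iff₀ (by positivity) (by positivity)]
  have hpi3 := pi_gt_three
  have hpi4 : π ≤ 3.15 := pi_lt_d2.le
  calc |S| * (1 + ((n + 1) * u) ^ 2) = |S| + (n + 1) ^ 2 * (|S| * u ^ 2) := by ring
    _ ≤ (n + 1) ^ 2 / 2 + (n + 1) ^ 2 * (π ^ 2 / 2) := by gcongr
    _ = (n + 1) ^ 2 * (1 / 2 + π ^ 2 / 2) := by ring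
    _ ≤ (n + 1) ^ 2 * (2 * π) := by gcongr; nlinarith
    _ = _ := by ring

lemma Function.Periodic.intervalIntegrable_of_integrable_periodMeasure {f : ℝ → ℝ}
    (hper : Function.Periodic f (2 * π)) (hf : Integrable f periodMeasure) (a b : ℝ) :
    IntervalIntegrable f volume a b :=
  hper.intervalIntegrable (t := 0) two_pi_pos.ne' (by
    rw [zero_add]
    exact (intervalIntegrable_iff_integrableOn_Ioc_of_le two_pi_pos.le).2 hf) a b

lemma Function.Periodic.integrable_comp_sub_left {f : ℝ → ℝ}
    (hper : Function.Periodic f (2 * π)) (hf : Integrable f periodMeasure) (x : ℝ) :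
    Integrable (fun u => f (x - u)) periodMeasure := by
  have := (hper.intervalIntegrable_of_integrable_periodMeasure hf x (x - 2 * π)).comp_sub_left x
  simp only [sub_self, sub_sub_cancel] at this
  exact (intervalIntegrable_iff_integrableOn_Ioc_of_le two_pi_pos.le).1 this

lemma fejerMean_eq_integral {f : ℝ → ℝ} (hper : Function.Periodic f (2 * π))
    (hf : Integrable f periodMeasure) (n : ℕ) (x : ℝ) :
    fejerMean f n x = ∫ u, fejerKernel n u * f (x - u) ∂periodMeasure := by
  have hD : ∀ k, Continuous fun t => dirichletKernel k (x - t) := fun k =>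
    (continuous_dirichletKernel k).comp (by fun_prop)
  have hg : Function.Periodic (fun u => fejerKernel n u * f (x - u)) (2 * π) := fun u => by
    simp only [periodic_fejerKernel n u, ← sub_sub, hper.sub_eq]
  rw [← integral_periodMeasure_comp_sub_left hg x]
  simp only [fejerMean, Pi.smul_apply, Finset.sum_apply, partialFourierSum_eq, smul_eq_mul,
    sub_sub_cancel, fejerKernel]
  rw [← Finset.mul_sum, ← integral_finsetSum _ fun k _ => hf.mul_continuous_periodMeasure (hD k),
    ← mul_assoc, ← integral_const_mul]
  refine integral_congr_ae (.of_forall fun t => ?_)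
  simp only [← Finset.mul_sum]
  field_simp

lemma integral_fejerKernel (n : ℕ) : ∫ u, fejerKernel n u ∂periodMeasure = 1 := by
  have h := fejerMean_eq_integral (f := fun _ => 1) (fun _ => rfl)
    (integrable_periodMeasure_of_continuous continuous_const) n 0
  simp only [mul_one] at h
  rw [← h]
  have h1 : ∀ k, partialFourierSum (fun _ => 1) k 0 = 1 := fun k => by
    simpa using partialFourierSum_cos (Nat.zero_le k) 0 0
  simp only [fejerMean, Pi.smul_apply, Finset.sum_apply, h1, smul_eq_mul, sum_const, card_range,
    nsmul_eq_mul, mul_one]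
  push_cast
  field_simp

lemma fejerMean_sub_eq_integral {f : ℝ → ℝ} (hper : Function.Periodic f (2 * π))
    (hf : Integrable f periodMeasure) (n : ℕ) (x : ℝ) :
    fejerMean f n x - f x =
      ∫ u in Set.Ioc (-π) π, fejerKernel n u * (f (x - u) - f x) := by
  have hg : Function.Periodic (fun u => fejerKernel n u * (f (x - u) - f x)) (2 * π) := fun u => by
    simp only [periodic_fejerKernel n u, ← sub_sub, hper.sub_eq]
  have hF := continuous_fejerKernel n
  have hi : Integrable (fun u => fejerKernel n u * f (x - u)) periodMeasure := by
    simpa only [mul_comm] using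
      (hper.integrable_comp_sub_left hf x).mul_continuous_periodMeasure hF
  have hshift := hg.intervalIntegral_add_eq 0 (-π)
  rw [zero_add, show -π + 2 * π = π by ring, ← integral_periodMeasure_eq,
    intervalIntegral.integral_of_le (by linarith [pi_pos])] at hshift
  rw [← hshift]
  simp only [mul_sub]
  rw [integral_sub hi ((integrable_periodMeasure_of_continuous hF).mul_const _),
    integral_mul_const, integral_fejerKernel, one_mul, fejerMean_eq_integral hper hf]

/-- Fejér means of an `L^p`-Hölder function of order `α < 1` converge at rate `n^{-α}`. -/
lemma exists_eLpNorm_fejerMean_sub_le {p α M : ℝ} (hp : 1 < p) (hα0 : 0 < α) (hα1 : α < 1)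
    (hM : 0 < M) {f : ℝ → ℝ} (hper : Function.Periodic f (2 * π))
    (hf : AEStronglyMeasurable f volume) (hfi : Integrable f periodMeasure)
    (hlip : ∀ h : ℝ, eLpNorm (fun x => f (x + h) - f x) (ENNReal.ofReal p) periodMeasure ≤
      ENNReal.ofReal (M * |h| ^ α)) :
    ∃ C : NNReal, ∀ n : ℕ,
      eLpNorm (fejerMean f n - f) (ENNReal.ofReal p) periodMeasure ≤
        C * ENNReal.ofReal (((n : ℝ) + 1) ^ (-α)) := by
  set G : ℝ → ℝ := fun v => (1 + ‖v‖ ^ 2) ^ (-(2 - α) / 2) with hG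
  have hGi : Integrable G volume := integrable_rpow_neg_one_add_norm_sq (by simp; linarith)
  have hG0 : ∀ v, 0 ≤ G v := fun v => by positivity
  refine ⟨(2 * M * ∫ v, G v).toNNReal, fun n => ?_⟩
  have hN : (0 : ℝ) < n + 1 := by positivity
  have hbound : ∀ u : ℝ, |u| ≤ π → |fejerKernel n u| * (M * |u| ^ α) ≤
      2 * M * ((n : ℝ) + 1) ^ (1 - α) * G ((n + 1) * u) := fun u hu => by
    have hpos : 0 < 1 + ((n + 1) * u) ^ 2 := by positivity
    have hu2 : ((n + 1) * |u|) ^ α ≤ (1 + ((n + 1) * u) ^ 2) ^ (α / 2) := by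
      rw [show α = 2 * (α / 2) by ring, rpow_mul (by positivity),
        mul_div_cancel_left₀ _ two_ne_zero]
      refine rpow_le_rpow (by positivity) ?_ (by positivity)
      rw [rpow_two, mul_pow, sq_abs, mul_pow]
      linarith
    rw [mul_rpow hN.le (abs_nonneg u)] at hu2
    have hsplit : G ((n + 1) * u) =
        (1 + ((n + 1) * u) ^ 2)⁻¹ * (1 + ((n + 1) * u) ^ 2) ^ (α / 2) := by
      simp only [hG, norm_eq_abs, sq_abs]
      rw [← rpow_neg_one, ← rpow_add hpos]
      congr 1; ring
    calc |fejerKernel n u| * (M * |u| ^ α)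
        ≤ 2 * (n + 1) / (1 + ((n + 1) * u) ^ 2) * (M * |u| ^ α) := by
          gcongr; exact abs_fejerKernel_le n hu
      _ = 2 * M * ((n : ℝ) + 1) ^ (1 - α) * ((1 + ((n + 1) * u) ^ 2)⁻¹ *
            (((n : ℝ) + 1) ^ α * |u| ^ α)) := by
          rw [rpow_sub hN, rpow_one]; field_simp
      _ ≤ _ := by rw [hsplit]; gcongr
  have hrep : fejerMean f n - f =
      fun x => ∫ u in Set.Ioc (-π) π, fejerKernel n u * (f (x - u) - f x) :=
    funext (fejerMean_sub_eq_integral hper hfi n)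
  rw [hrep]
  have hne : ∀ᵐ u ∂(volume.restrict (Set.Ioc (-π) π)), u ≠ 0 :=
    ae_restrict_of_ae (Measure.ae_ne volume 0)
  calc _ ≤ ∫⁻ u in Set.Ioc (-π) π, ‖fejerKernel n u‖ₑ * ENNReal.ofReal (M * |u| ^ α) := by
        refine eLpNorm_integral_mul_le hp (continuous_fejerKernel n).measurable ?_
          (by fun_prop) ?_ (.of_forall fun _ => ENNReal.ofReal_ne_top) ?_
        · refine (aestronglyMeasurable_prod_comp_sub hf Measure.absolutelyContinuous_restrict
            Measure.absolutelyContinuous_restrict).sub ?_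
          exact hf.restrict.comp_fst
        · filter_upwards [hne] with u hu
          have : 0 < M * |u| ^ α := by positivity
          simpa using this
        · refine .of_forall fun u => ?_
          simpa [sub_eq_add_neg] using hlip (-u)
    _ ≤ ∫⁻ u in Set.Ioc (-π) π,
          ENNReal.ofReal (2 * M * ((n : ℝ) + 1) ^ (1 - α) * G ((n + 1) * u)) := by
        refine setLIntegral_mono' measurableSet_Ioc fun u hu => ?_
        rw [← ofReal_norm, ← ENNReal.ofReal_mul (norm_nonneg _)]
        exact ENNReal.ofReal_le_ofReal (hbound u (abs_le.2 ⟨hu.1.le, hu.2⟩))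
    _ ≤ ∫⁻ u, ENNReal.ofReal (2 * M * ((n : ℝ) + 1) ^ (1 - α) * G ((n + 1) * u)) :=
        setLIntegral_le_lintegral _ _
    _ = ENNReal.ofReal (∫ u, 2 * M * ((n : ℝ) + 1) ^ (1 - α) * G ((n + 1) * u)) := by
        rw [ofReal_integral_eq_lintegral_ofReal ((hGi.comp_mul_left' hN.ne').const_mul _)
          (.of_forall fun u => by have := hG0 ((n + 1) * u); positivity)]
    _ = _ := by
        rw [integral_const_mul, Measure.integral_comp_mul_left G, smul_eq_mul,
          abs_of_pos (by positivity), ← ENNReal.ofReal_coe_nnreal,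
          ← ENNReal.ofReal_mul NNReal.zero_le_coe,
          Real.coe_toNNReal _ (by have : 0 ≤ ∫ v, G v := integral_nonneg hG0; positivity)]
        congr 1
        rw [show (1 : ℝ) - α = -α + 1 by ring, rpow_add_one hN.ne']
        field_simp

lemma lpNorm_eq_eLpNorm {p : ℝ} (hp : 0 < p) {g : ℝ → ℝ}
    (hg : AEStronglyMeasurable g periodMeasure) :
    lpNorm p g = (1 / (2 * π)) ^ (1 / p) *
      (eLpNorm g (ENNReal.ofReal p) periodMeasure).toReal := by
  have hm : AEStronglyMeasurable (fun x => |g x| ^ p) periodMeasure :=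
    (hg.norm.aemeasurable.pow_const p).aestronglyMeasurable
  rw [_root_.lpNorm, ← integral_periodMeasure_eq, eLpNorm_eq_lintegral_rpow_enorm_toReal
    (by simpa using hp) ENNReal.ofReal_ne_top, ENNReal.toReal_ofReal hp.le,
    integral_eq_lintegral_of_nonneg_ae (.of_forall fun x => by positivity) hm,
    mul_rpow (by positivity) ENNReal.toReal_nonneg, ENNReal.toReal_rpow]
  congr 3
  refine lintegral_congr fun x => ?_
  rw [← ofReal_norm, ENNReal.ofReal_rpow_of_nonneg (norm_nonneg _) hp.le, norm_eq_abs]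

lemma Function.Periodic.aestronglyMeasurable_of_integrable_periodMeasure {f : ℝ → ℝ}
    (hper : Function.Periodic f (2 * π)) (hf : Integrable f periodMeasure) :
    AEStronglyMeasurable f volume := by
  have huniv : ⋃ n : ℕ, Set.Ioc (-(n : ℝ)) n = Set.univ := by
    refine Set.eq_univ_of_forall fun x => Set.mem_iUnion.2 ?_
    obtain ⟨n, hn⟩ := exists_nat_gt |x|
    exact ⟨n, (abs_lt.1 hn).1, (abs_lt.1 hn).2.le⟩
  rw [← Measure.restrict_univ (μ := volume), ← huniv, aestronglyMeasurable_iUnion_iff]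
  exact fun n => (hper.intervalIntegrable_of_integrable_periodMeasure hf _ _).1.aestronglyMeasurable

lemma LipClass.integrable {α p : ℝ} {f : ℝ → ℝ} (hf : LipClass α p f) :
    Integrable f periodMeasure :=
  (intervalIntegrable_iff_integrableOn_Ioc_of_le two_pi_pos.le).1 hf.2.1

lemma LipClass.memLp {α p : ℝ} (hp : 1 < p) {f : ℝ → ℝ} (hf : LipClass α p f) :
    MemLp f (ENNReal.ofReal p) periodMeasure := by
  have hp0 : 0 < p := by linarith
  rw [← integrable_norm_rpow_iff hf.integrable.aestronglyMeasurable (by simpa using hp0)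
    ENNReal.ofReal_ne_top, ENNReal.toReal_ofReal hp0.le]
  exact (intervalIntegrable_iff_integrableOn_Ioc_of_le two_pi_pos.le).1 hf.2.2.1

lemma LipClass.exists_eLpNorm_le {α p : ℝ} (hp : 1 < p) {f : ℝ → ℝ}
    (hf : LipClass α p f) :
    ∃ M : ℝ, 0 < M ∧ ∀ h : ℝ, eLpNorm (fun x => f (x + h) - f x) (ENNReal.ofReal p) periodMeasure ≤
      ENNReal.ofReal (M * |h| ^ α) := by
  have hp0 : 0 < p := by linarith
  have hper := hf.1
  have hfm := hper.aestronglyMeasurable_of_integrable_periodMeasure hf.integrable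
  have hmem := hf.memLp hp
  obtain ⟨C, hC0, hC⟩ := hf.2.2.2
  set c : ℝ := (1 / (2 * π)) ^ (1 / p) with hc
  have hc0 : 0 < c := by positivity
  have hshift : ∀ h, AEStronglyMeasurable (fun x => f (x + h)) periodMeasure := fun h =>
    (hfm.comp_quasiMeasurePreserving
      (measurePreserving_add_right volume h).quasiMeasurePreserving).restrict
  have hdm : ∀ h, AEStronglyMeasurable (fun x => f (x + h) - f x) periodMeasure := fun h =>
    (hshift h).sub hmem.1
  have hle : ∀ h, eLpNorm (fun x => f (x + h) - f x) (ENNReal.ofReal p) periodMeasure ≤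
      2 * eLpNorm f (ENNReal.ofReal p) periodMeasure := fun h => by
    refine (eLpNorm_sub_le (hshift h) hmem.1 (by simpa using hp.le)).trans_eq ?_
    rw [eLpNorm_periodMeasure_comp_add hper hp0, two_mul]
  have htop : 2 * eLpNorm f (ENNReal.ofReal p) periodMeasure ≠ ⊤ :=
    ENNReal.mul_ne_top (by simp) hmem.2.ne
  refine ⟨C / c, by positivity, fun h => ?_⟩
  rcases eq_or_ne h 0 with rfl | hh
  · simp
  have hmod : lpNorm p (fun x => f (x + h) - f x) ≤ C * |h| ^ α := by
    refine le_trans ?_ (hC |h| (abs_pos.2 hh))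
    refine le_csSup ?_ ⟨h, abs_pos.2 hh, le_rfl, rfl⟩
    refine ⟨c * (2 * eLpNorm f (ENNReal.ofReal p) periodMeasure).toReal, ?_⟩
    rintro y ⟨k, -, -, rfl⟩
    have hk := lpNorm_eq_eLpNorm hp0 (hdm k)
    rw [_root_.lpNorm] at hk
    rw [hk]
    exact mul_le_mul_of_nonneg_left (ENNReal.toReal_mono htop (hle k)) hc0.le
  rw [lpNorm_eq_eLpNorm hp0 (hdm h)] at hmod
  rw [← ENNReal.ofReal_toReal ((hle h).trans_lt htop.lt_top).ne]
  refine ENNReal.ofReal_le_ofReal ?_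
  rw [div_mul_eq_mul_div, le_div_iff₀ hc0, mul_comm]
  exact hmod

/-- Fourier partial sums of a function in `Lip(α,p)`, `0 < α < 1`, converge at rate `n^{-α}`. -/
lemma LipClass.exists_eLpNorm_partialFourierSum_sub_le {p α : ℝ} (hp : 1 < p) (hα0 : 0 < α)
    (hα1 : α < 1) {f : ℝ → ℝ} (hf : LipClass α p f) :
    ∃ C : NNReal, ∀ n : ℕ,
      eLpNorm (partialFourierSum f n - f) (ENNReal.ofReal p) periodMeasure ≤
        C * ENNReal.ofReal (((n : ℝ) + 1) ^ (-α)) := by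
  have hfi := hf.integrable
  have hfm := hf.1.aestronglyMeasurable_of_integrable_periodMeasure hfi
  obtain ⟨M, hM, hlip⟩ := hf.exists_eLpNorm_le hp
  obtain ⟨A, hA⟩ := exists_eLpNorm_fejerMean_sub_le hp hα0 hα1 hM hf.1 hfm hfi hlip
  obtain ⟨B, hB⟩ := _root_.exists_eLpNorm_partialFourierSum_sub_le hp
  refine ⟨B * A, fun n => (hB f hf.1 hfm hfi n).trans ?_⟩
  rw [ENNReal.coe_mul, mul_assoc]
  exact mul_le_mul_right (hA n) _

/-- If the partial sums of `a` are dominated by those of the constant `c`, then weighted sums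
against antitone nonnegative weights are dominated too. -/
lemma sum_mul_le_mul_sum_of_antitone {a b : ℕ → ℝ} {c : ℝ} {n : ℕ} (hb : Antitone b)
    (hb0 : ∀ k, 0 ≤ b k) (ha : ∀ m < n, ∑ k ∈ range (m + 1), a k ≤ c * (m + 1)) :
    ∑ k ∈ range n, a k * b k ≤ c * ∑ k ∈ range n, b k := by
  have key : ∀ m ≤ n, ∑ k ∈ range m, (a k - c) * b k ≤ (∑ k ∈ range m, (a k - c)) * b m := by
    intro m
    induction m with
    | zero => simp
    | succ m ih =>
      intro hm
      have hle : ∑ k ∈ range (m + 1), (a k - c) ≤ 0 := by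
        rw [sum_sub_distrib, sum_const, card_range, nsmul_eq_mul]
        push_cast
        linarith [ha m (by omega)]
      calc ∑ k ∈ range (m + 1), (a k - c) * b k
          ≤ (∑ k ∈ range (m + 1), (a k - c)) * b m := by
            rw [sum_range_succ, sum_range_succ, add_mul]
            linarith [ih (by omega)]
        _ ≤ _ := mul_le_mul_of_nonpos_left (hb (Nat.le_succ m)) hle
  have hn := key n le_rfl
  have hle : (∑ k ∈ range n, (a k - c)) * b n ≤ 0 := by
    refine mul_nonpos_of_nonpos_of_nonneg ?_ (hb0 n)
    cases n with
    | zero => simp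
    | succ m =>
      rw [sum_sub_distrib, sum_const, card_range, nsmul_eq_mul]
      push_cast
      linarith [ha m (by omega)]
  simp only [sub_mul, sum_sub_distrib, ← mul_sum] at hn hle
  linarith

lemma sum_rpow_neg_le {α : ℝ} (hα0 : 0 ≤ α) (hα1 : α < 1) (n : ℕ) :
    ∑ k ∈ range n, ((k : ℝ) + 1) ^ (-α) ≤ (n : ℝ) ^ (1 - α) / (1 - α) := by
  have h1α : 0 < 1 - α := by linarith
  induction n with
  | zero => simp [zero_rpow h1α.ne']
  | succ n ih =>
    have hN : (0 : ℝ) < n + 1 := by positivity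
    rw [sum_range_succ]
    push_cast
    have hbern : ((n : ℝ) / (n + 1)) ^ (1 - α) ≤ 1 + (1 - α) * (-(1 / (n + 1))) := by
      have hge : -1 ≤ -(1 / ((n : ℝ) + 1)) := by
        rw [neg_le_neg_iff, div_le_one hN]; linarith [(Nat.cast_nonneg n : (0 : ℝ) ≤ n)]
      have := rpow_one_add_le_one_add_mul_self hge h1α.le (by linarith)
      rwa [show 1 + -(1 / ((n : ℝ) + 1)) = n / (n + 1) by field_simp; ring] at this
    rw [div_rpow (by positivity) hN.le, div_le_iff₀ (by positivity)] at hbern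
    have hexp : ((n : ℝ) + 1) ^ (1 - α) = (n + 1) * (n + 1) ^ (-α) := by
      rw [sub_eq_add_neg, rpow_add hN, rpow_one]
    have hcancel : (1 + (1 - α) * (-(1 / ((n : ℝ) + 1)))) * (n + 1) ^ (1 - α) =
        (n + 1) ^ (1 - α) - (1 - α) * (n + 1) ^ (-α) := by
      rw [hexp]; field_simp; ring
    rw [hcancel] at hbern
    rw [le_div_iff₀ h1α] at ih ⊢
    linarith

/-- Weighted sums of `(k+1)^{-α}` against a row of an `AMIMS` matrix. -/
lemma sum_mul_rpow_neg_le_of_rowMean_le {a : ℕ → ℕ → ℝ} {α K R : ℝ} (hα0 : 0 ≤ α) (hα1 : α < 1)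
    {n : ℕ} (hpos : ∀ k ≤ n, 0 ≤ a n k) (hR : ∑ k ∈ range (n + 1), a n k ≤ R)
    (hK : ∀ l ≤ n, rowMean a n l ≤ K * rowMean a n n) :
    ∑ k ∈ range (n + 1), a n k * ((k : ℝ) + 1) ^ (-α) ≤
      |K| * R / (1 - α) * ((n : ℝ) + 1) ^ (-α) := by
  have hN : (0 : ℝ) < n + 1 := by positivity
  have h0 : 0 ≤ ∑ k ∈ range (n + 1), a n k :=
    sum_nonneg fun k hk => hpos k (Nat.lt_succ_iff.1 (mem_range.1 hk))
  have hanti : Antitone fun k : ℕ => ((k : ℝ) + 1) ^ (-α) := fun i j hij =>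
    rpow_le_rpow_of_nonpos (by positivity) (by gcongr) (by linarith)
  have hpartial : ∀ m < n + 1, ∑ k ∈ range (m + 1), a n k ≤ |K| * R / (n + 1) * (m + 1) := by
    intro m hm
    have hM : (0 : ℝ) < m + 1 := by positivity
    have h := hK m (Nat.lt_succ_iff.1 hm)
    have hle : K * rowMean a n n ≤ |K| * R / (n + 1) := by
      rw [rowMean, mul_div_assoc, div_eq_inv_mul R, one_div]
      exact mul_le_mul (le_abs_self K) (by gcongr) (by positivity) (abs_nonneg K)
    rw [rowMean, one_div_mul_eq_div] at h
    exact (div_le_iff₀ hM).1 (h.trans hle)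
  refine (sum_mul_le_mul_sum_of_antitone hanti (fun k => by positivity) hpartial).trans ?_
  have hsum := sum_rpow_neg_le hα0 hα1 (n + 1)
  push_cast at hsum
  have hc : 0 ≤ |K| * R / (n + 1) := div_nonneg (mul_nonneg (abs_nonneg K) (h0.trans hR)) hN.le
  refine (mul_le_mul_of_nonneg_left hsum hc).trans_eq ?_
  rw [sub_eq_add_neg 1 α, rpow_add hN, rpow_one]
  field_simp

lemma eLpNorm_matrixMeans_sub_le {a : ℕ → ℕ → ℝ} {f : ℝ → ℝ} {p : ℝ} (hp : 1 < p)
    (hf : Integrable f periodMeasure) {n : ℕ} (hpos : ∀ k ≤ n, 0 ≤ a n k) :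
    eLpNorm (fun x => matrixMeans a f n x - f x) (ENNReal.ofReal p) periodMeasure ≤
      (∑ k ∈ range (n + 1), ENNReal.ofReal (a n k) *
        eLpNorm (partialFourierSum f k - f) (ENNReal.ofReal p) periodMeasure) +
      ENNReal.ofReal |(∑ k ∈ range (n + 1), a n k) - 1| *
        eLpNorm f (ENNReal.ofReal p) periodMeasure := by
  have hp1 : 1 ≤ ENNReal.ofReal p := by simpa using hp.le
  have hrep : (fun x => matrixMeans a f n x - f x) =
      (∑ k ∈ range (n + 1), a n k • (partialFourierSum f k - f)) +
        ((∑ k ∈ range (n + 1), a n k) - 1) • f := by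
    ext x
    simp only [matrixMeans, Pi.add_apply, Finset.sum_apply, Pi.smul_apply, Pi.sub_apply,
      smul_eq_mul, mul_sub, sum_sub_distrib, ← sum_mul]
    ring
  have hm : ∀ k, AEStronglyMeasurable (a n k • (partialFourierSum f k - f)) periodMeasure :=
    fun k => ((continuous_partialFourierSum hf k).aestronglyMeasurable.sub
      hf.aestronglyMeasurable).const_smul _
  rw [hrep]
  refine (eLpNorm_add_le (Finset.aestronglyMeasurable_sum _ fun k _ => hm k)
    (hf.aestronglyMeasurable.const_smul _) hp1).trans (add_le_add ?_ ?_)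
  · refine (eLpNorm_sum_le (fun k _ => hm k) hp1).trans (sum_le_sum fun k hk => ?_)
    rw [eLpNorm_const_smul, ← ofReal_norm,
      norm_of_nonneg (hpos k (Nat.lt_succ_iff.1 (mem_range.1 hk)))]
  · rw [eLpNorm_const_smul, ← ofReal_norm, norm_eq_abs]

/-- Remark 1 for case (i): if `f ∈ Lip(α,p)`, `p > 1`, `0 < α < 1`,
the matrix is nonnegative, lower triangular, satisfies
`|∑_{k=0}^n a_{n,k} - 1| = O(n^{-α})` (in place of row sums equal to `1`), and its
rows are in `AMIMS` with a constant independent of `n`, then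
`‖T_n(f) - f‖_{L^p} = O(n^{-α})`. -/
theorem trig_approx_AMIMS_approx_row_sums (p α : ℝ) (hp : 1 < p)
    (hα0 : 0 < α) (hα1 : α < 1)
    (f : ℝ → ℝ) (hf : LipClass α p f)
    (a : ℕ → ℕ → ℝ)
    (hpos : ∀ n k, k ≤ n → 0 ≤ a n k)
    (hzero : ∀ n k, n < k → a n k = 0)
    (hsum : ∃ C : ℝ, ∀ n : ℕ, 1 ≤ n →
      |(∑ k ∈ Finset.range (n + 1), a n k) - 1| ≤ C * (n : ℝ) ^ (-α))
    (hAMIMS : ∃ K : ℝ, ∀ n l m : ℕ, l ≤ m → m ≤ n → rowMean a n l ≤ K * rowMean a n m) :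
    ∃ C : ℝ, ∀ n : ℕ, 1 ≤ n →
      lpNorm p (fun x => matrixMeans a f n x - f x) ≤ C * (n : ℝ) ^ (-α) := by
  obtain ⟨B, hB⟩ := hf.exists_eLpNorm_partialFourierSum_sub_le hp hα0 hα1
  obtain ⟨A, hA⟩ := hsum
  obtain ⟨K, hK⟩ := hAMIMS
  have hfi := hf.integrable
  have hfm := hf.memLp hp
  set F := (eLpNorm f (ENNReal.ofReal p) periodMeasure).toReal with hF
  have hFe : eLpNorm f (ENNReal.ofReal p) periodMeasure = ENNReal.ofReal F :=
    (ENNReal.ofReal_toReal hfm.2.ne).symm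
  have hF0 : 0 ≤ F := ENNReal.toReal_nonneg
  refine ⟨(1 / (2 * π)) ^ (1 / p) * (B * (|K| * (1 + |A|) / (1 - α)) + A * F), fun n hn => ?_⟩
  have hn1 : (1 : ℝ) ≤ n := by exact_mod_cast hn
  have hpow1 : (n : ℝ) ^ (-α) ≤ 1 := rpow_le_one_of_one_le_of_nonpos hn1 (by linarith)
  have hpow0 : 0 ≤ (n : ℝ) ^ (-α) := by positivity
  have hR : ∑ k ∈ range (n + 1), a n k ≤ 1 + |A| := by
    have h1 := (le_abs_self _).trans (hA n hn)
    have h2 : A * (n : ℝ) ^ (-α) ≤ |A| :=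
      (mul_le_mul_of_nonneg_right (le_abs_self A) hpow0).trans
        (mul_le_of_le_one_right (abs_nonneg A) hpow1)
    linarith
  have hrow := sum_mul_rpow_neg_le_of_rowMean_le hα0.le hα1 (hpos n) hR
    fun l hl => hK n l n hl le_rfl
  have hc : 0 ≤ |K| * (1 + |A|) / (1 - α) := div_nonneg (by positivity) (by linarith)
  have hmain : eLpNorm (fun x => matrixMeans a f n x - f x) (ENNReal.ofReal p) periodMeasure ≤
      ENNReal.ofReal ((B * (|K| * (1 + |A|) / (1 - α)) + A * F) * (n : ℝ) ^ (-α)) := by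
    refine (eLpNorm_matrixMeans_sub_le hp hfi (hpos n)).trans ?_
    calc _ ≤ (∑ k ∈ range (n + 1), ENNReal.ofReal (a n k) *
            (B * ENNReal.ofReal (((k : ℝ) + 1) ^ (-α)))) +
          ENNReal.ofReal |(∑ k ∈ range (n + 1), a n k) - 1| * ENNReal.ofReal F := by
          rw [hFe]
          exact add_le_add_left (sum_le_sum fun k _ => mul_le_mul_right (hB k) _) _
      _ = ENNReal.ofReal (B * ∑ k ∈ range (n + 1), a n k * ((k : ℝ) + 1) ^ (-α)) +
          ENNReal.ofReal (|(∑ k ∈ range (n + 1), a n k) - 1| * F) := by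
          rw [ENNReal.ofReal_mul (abs_nonneg _), mul_sum, ENNReal.ofReal_sum_of_nonneg]
          · congr 1
            refine sum_congr rfl fun k hk => ?_
            rw [ENNReal.ofReal_mul B.coe_nonneg, ENNReal.ofReal_coe_nnreal,
              ENNReal.ofReal_mul (hpos n k (Nat.lt_succ_iff.1 (mem_range.1 hk)))]
            ring
          · intro k hk
            have := hpos n k (Nat.lt_succ_iff.1 (mem_range.1 hk))
            positivity
      _ ≤ ENNReal.ofReal (B * (|K| * (1 + |A|) / (1 - α)) * (n : ℝ) ^ (-α)) +
          ENNReal.ofReal (A * F * (n : ℝ) ^ (-α)) := by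
          refine add_le_add (ENNReal.ofReal_le_ofReal ?_) (ENNReal.ofReal_le_ofReal ?_)
          · rw [mul_assoc]
            refine mul_le_mul_of_nonneg_left (hrow.trans (mul_le_mul_of_nonneg_left ?_ hc))
              B.coe_nonneg
            exact rpow_le_rpow_of_nonpos (by positivity) (by linarith) (by linarith)
          · rw [mul_right_comm]
            exact mul_le_mul_of_nonneg_right (hA n hn) hF0
      _ = _ := by
          have hA0 : 0 ≤ A * F * (n : ℝ) ^ (-α) := by
            rw [mul_right_comm]
            exact mul_nonneg ((abs_nonneg _).trans (hA n hn)) hF0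
          rw [← ENNReal.ofReal_add (by positivity) hA0, add_mul]
  have hm : AEStronglyMeasurable (fun x => matrixMeans a f n x - f x) periodMeasure := by
    refine AEStronglyMeasurable.sub (Continuous.aestronglyMeasurable ?_) hfm.1
    exact continuous_finsetSum _ fun k _ => (continuous_partialFourierSum hfi k).const_mul _
  rw [lpNorm_eq_eLpNorm (by linarith) hm, mul_assoc]
  refine mul_le_mul_of_nonneg_left (ENNReal.toReal_le_of_le_ofReal ?_ hmain) (by positivity)
  have hA0 : 0 ≤ A * (n : ℝ) ^ (-α) := (abs_nonneg _).trans (hA n hn)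
  rw [add_mul, mul_right_comm A]
  positivity
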